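/- arXiv:1912.11769 — 2 statements merged into one kernel-verified Lean document; each statement's English description precedes it below -/
import Mathlib

section
/- Fix real parameters γ ∈ (0,1), α > 0, μ > 0, κ > 0 with κ(1+α) ∈ (0,1), and set x_j = μα/((1+α)^((1+α)/α) κ^(1/α)), ω = √(1−γ²), x_d = −x_j·exp(−γπ/ω). Let u : ℝ → ℝ² be the solution of the linear system ẋ = y, ẏ = −x − 2γy with u(0) = (x_j, 0), let Γ¹ = {u(t) : t ∈ [0, π/ω]}, Γ² = [x_d, x_j] × {0}, and Γ₀ = Γ¹ ∪ Γ². Then, denoting by Γ_ε the unique attracting periodic orbit of the Hester system in a fixed sufficiently large ball (which exists for all small ε > 0), the Hausdorff distance between Γ_ε and Γ₀ tends to 0 as ε → 0⁺. -/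
/-- The vector field of the Hester system. -/
noncomputable def hesterField (γ α μ κ ε : ℝ) (p : ℝ × ℝ) : ℝ × ℝ :=
  (p.2, -p.1 - 2 * γ * p.2 + μ * (Real.exp (p.2 / ε) - κ * Real.exp ((1 + α) * p.2 / ε)))

/-- `p` is a nonconstant periodic solution of the planar ODE with vector field `f`. -/
def IsPeriodicSol (f : ℝ × ℝ → ℝ × ℝ) (p : ℝ → ℝ × ℝ) : Prop :=
  (∀ t : ℝ, HasDerivAt p (f (p t)) t) ∧
  (∃ T > (0 : ℝ), ∀ t : ℝ, p (t + T) = p t) ∧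
  (∃ t₁ t₂ : ℝ, p t₁ ≠ p t₂)

/-- A fencing argument: `f` cannot cross `B` upwards. -/
lemma fence {f f' B B' : ℝ → ℝ} {a b : ℝ} (hf : ∀ t, HasDerivAt f (f' t) t)
    (hB : ∀ t, HasDerivAt B (B' t) t) (ha : f a ≤ B a)
    (bound : ∀ t ∈ Set.Ico a b, f t = B t → f' t < B' t) :
    ∀ t ∈ Set.Icc a b, f t ≤ B t := fun _ ht =>
  image_le_of_deriv_right_lt_deriv_boundary'
    (fun t _ => (hf t).continuousAt.continuousWithinAt)
    (fun t _ => (hf t).hasDerivWithinAt) ha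
    (fun t _ => (hB t).continuousAt.continuousWithinAt)
    (fun t _ => (hB t).hasDerivWithinAt) bound ht

lemma sub_le_mul_of_deriv_le {f f' : ℝ → ℝ} {a b c : ℝ} (hf : ∀ t, HasDerivAt f (f' t) t)
    (hab : a ≤ b) (h : ∀ t ∈ Set.Ioo a b, f' t ≤ c) : f b - f a ≤ c * (b - a) := by
  refine (convex_Icc a b).image_sub_le_mul_sub_of_deriv_le
    (fun t _ => (hf t).continuousAt.continuousWithinAt)
    (fun t _ => (hf t).differentiableAt.differentiableWithinAt) ?_ a ?_ b ?_ hab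
  · intro t ht
    rw [interior_Icc] at ht
    rw [(hf t).deriv]
    exact h t ht
  · exact ⟨le_rfl, hab⟩
  · exact ⟨hab, le_rfl⟩

lemma mul_le_sub_of_le_deriv {f f' : ℝ → ℝ} {a b c : ℝ} (hf : ∀ t, HasDerivAt f (f' t) t)
    (hab : a ≤ b) (h : ∀ t ∈ Set.Ioo a b, c ≤ f' t) : c * (b - a) ≤ f b - f a := by
  have := sub_le_mul_of_deriv_le (c := -c) (fun t => (hf t).neg) hab
    (fun t ht => neg_le_neg (h t ht))
  simp only [Pi.neg_apply] at this
  linarith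

/-- Either a function that is positive just after `0` stays positive up to time `C`, or it has a
first zero. -/
lemma pos_or_exists_first_zero {y : ℝ → ℝ} (hy : Continuous y)
    (h0 : ∀ᶠ t in nhdsWithin 0 (Set.Ioi (0 : ℝ)), 0 < y t) (C : ℝ) :
    (∀ t ∈ Set.Ioc 0 C, 0 < y t) ∨
      ∃ T ∈ Set.Ioc 0 C, y T = 0 ∧ ∀ t ∈ Set.Ioo 0 T, 0 < y t := by
  by_cases H : ∀ t ∈ Set.Ioc 0 C, 0 < y t
  · exact Or.inl H
  right
  push Not at H
  obtain ⟨t₁, ht₁, hy₁⟩ := H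
  obtain ⟨d, hd, hdy⟩ := mem_nhdsGT_iff_exists_Ioo_subset.1 h0
  have hd0 : (0 : ℝ) < d := hd
  have hne : Set.Nonempty {t | t ∈ Set.Icc (min (d / 2) t₁) t₁ ∧ y t ≤ 0} :=
    ⟨t₁, ⟨min_le_right _ _, le_rfl⟩, hy₁⟩
  have hcl : IsCompact {t | t ∈ Set.Icc (min (d / 2) t₁) t₁ ∧ y t ≤ 0} :=
    isCompact_Icc.inter_right (isClosed_le hy continuous_const)
  obtain ⟨T, ⟨hT, hyT⟩, hmin⟩ := hcl.exists_isLeast hne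
  have hm0 : 0 < min (d / 2) t₁ := lt_min (by linarith) ht₁.1
  have hpos : ∀ t ∈ Set.Ioo 0 T, 0 < y t := by
    intro t ht
    by_contra hneg
    push Not at hneg
    rcases le_or_gt (min (d / 2) t₁) t with h | h
    · have := hmin ⟨⟨h, ht.2.le.trans hT.2⟩, hneg⟩
      linarith [ht.2]
    · have hlt : t < d := by
        have := min_le_left (d / 2) t₁
        linarith
      have : 0 < y t := hdy ⟨ht.1, hlt⟩
      linarith
  have hT0 : 0 < T := hm0.trans_le hT.1
  refine ⟨T, ⟨hT0, hT.2.trans ht₁.2⟩, le_antisymm hyT ?_, hpos⟩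
  have : T ∈ closure (Set.Ioo 0 T) := by
    rw [closure_Ioo hT0.ne]; exact ⟨hT0.le, le_rfl⟩
  exact (isClosed_le continuous_const hy).closure_subset_iff.2
    (fun t ht => (hpos t ht).le) this

lemma eventually_pos_of_hasDerivAt {y : ℝ → ℝ} {d : ℝ} (h : HasDerivAt y d 0) (h0 : y 0 = 0)
    (hd : 0 < d) : ∀ᶠ t in nhdsWithin 0 (Set.Ioi (0 : ℝ)), 0 < y t := by
  have := (hasDerivAt_iff_tendsto_slope.1 h).mono_left
    (nhdsWithin_mono 0 (fun t (ht : t ∈ Set.Ioi (0 : ℝ)) => ne_of_gt ht))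
  filter_upwards [this.eventually (lt_mem_nhds hd), self_mem_nhdsWithin] with t ht ht0
  rw [slope_def_field, h0, sub_zero, sub_zero] at ht
  have ht1 : (0 : ℝ) < t := ht0
  exact (div_pos_iff_of_pos_right ht1).1 ht

/-- A globally Lipschitz `C¹` vector field is complete. -/
lemma exists_global_solution {E : Type*} [NormedAddCommGroup E] [NormedSpace ℝ E]
    [CompleteSpace E] {f : E → E} (hf : ContDiff ℝ 1 f) {K : NNReal} (hK : LipschitzWith K f)
    (x : E) : ∃ q : ℝ → E, q 0 = x ∧ ∀ t, HasDerivAt q (f (q t)) t := by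
  have key : ∀ x : E, ∃ q : ℝ → E, q 0 = x ∧
      IsMIntegralCurveOn (I := modelWithCornersSelf ℝ E) q f
        (Set.Ioo (-(1 / (2 * (K + 1)))) (1 / (2 * (K + 1)))) := by
    intro x
    set h : ℝ := 1 / (2 * (K + 1)) with hh
    have hK1 : (0 : ℝ) < K + 1 := by positivity
    have hh0 : 0 < h := by positivity
    have hPL : IsPicardLindelof (fun _ => f) (tmin := -h) (tmax := h)
        ⟨0, by constructor <;> linarith⟩ x (‖f x‖₊ + 1) 0
        (‖f x‖₊ + K * (‖f x‖₊ + 1)) K := by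
      refine IsPicardLindelof.of_time_independent ?_ hK.lipschitzOnWith ?_
      · intro z hz
        have h1 : ‖f z - f x‖ ≤ K * ‖z - x‖ := by
          simpa [dist_eq_norm] using hK.dist_le_mul z x
        have h2 : ‖z - x‖ ≤ ‖f x‖ + 1 := by
          simpa [dist_eq_norm] using hz
        have h3 : ‖f z‖ ≤ ‖f x‖ + ‖f z - f x‖ := norm_le_insert' (f z) (f x)
        push_cast
        have : (K : ℝ) * ‖z - x‖ ≤ K * (‖f x‖ + 1) := by gcongr
        linarith
      · have hn : (0 : ℝ) ≤ ‖f x‖ := norm_nonneg _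
        have hKn : (0 : ℝ) ≤ K := K.2
        simp only [sub_zero, zero_sub, neg_neg, max_self, NNReal.coe_add, NNReal.coe_mul,
          coe_nnnorm, NNReal.coe_one, NNReal.coe_zero]
        rw [hh, mul_one_div, div_le_iff₀ (by positivity)]
        nlinarith [mul_nonneg hn hKn]
    obtain ⟨q, hq0, hq⟩ := hPL.exists_eq_forall_mem_Icc_hasDerivWithinAt₀
    refine ⟨q, hq0, ?_⟩
    intro t ht
    have := ((hq t ⟨ht.1.le, ht.2.le⟩).hasDerivAt (Icc_mem_nhds ht.1 ht.2)).hasFDerivAt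
    exact this.hasMFDerivAt.hasMFDerivWithinAt
  obtain ⟨q, hq0, hq⟩ := exists_isMIntegralCurve_of_isMIntegralCurveOn
    (I := modelWithCornersSelf ℝ E) (v := f) (contMDiff_vectorSpace_iff_contDiff.2 hf)
    (by positivity) key x
  refine ⟨q, hq0, fun t => ?_⟩
  have h : HasFDerivAt q ((1 : ℝ →L[ℝ] ℝ).smulRight (f (q t)) : ℝ →L[ℝ] E) t :=
    hasMFDerivAt_iff_hasFDerivAt.1 (hq t)
  simpa using h.hasDerivAt

/-- `(x, y)` is a global trajectory of `ẋ = y`, `ẏ = -x + G y`. -/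
def IsTraj (G x y : ℝ → ℝ) : Prop :=
  (∀ t, HasDerivAt x (y t) t) ∧ ∀ t, HasDerivAt y (-x t + G (y t)) t

lemma IsTraj.shift {G x y : ℝ → ℝ} (h : IsTraj G x y) (c : ℝ) :
    IsTraj G (fun t => x (t + c)) (fun t => y (t + c)) :=
  ⟨fun t => (h.1 (t + c)).comp_add_const t c, fun t => (h.2 (t + c)).comp_add_const t c⟩

lemma IsTraj.continuous_fst {G x y : ℝ → ℝ} (h : IsTraj G x y) : Continuous x :=
  continuous_iff_continuousAt.2 fun t => (h.1 t).continuousAt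

lemma IsTraj.continuous_snd {G x y : ℝ → ℝ} (h : IsTraj G x y) : Continuous y :=
  continuous_iff_continuousAt.2 fun t => (h.2 t).continuousAt

/-- The properties of the nonlinearity used in the phase plane analysis; `s₁` is the (rescaled)
height of the fold, `s₀` the height at which the critical manifold crosses `x = 0`, and `S` a
height above the part of the critical manifold in a ball of radius `r`. -/
structure IsProfile (γ μ e X r s₁ s₀ S L m ε : ℝ) (G : ℝ → ℝ) : Prop where
  γ_pos : 0 < γ
  μ_pos : 0 < μ
  e_pos : 0 < e
  e_lt : e < X
  X_lt : X + 1 ≤ r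
  s₁_pos : 0 < s₁
  s₁_lt : s₁ < s₀
  s₀_lt : s₀ < S
  L_pos : 0 < L
  m_pos : 0 < m
  ε_pos : 0 < ε
  ε_le : ε ≤ 1
  lip : ∀ y ≤ ε * S, ∀ z ≤ ε * S, |G y - G z| ≤ L / ε * |y - z|
  zero : G 0 = e
  le_X : ∀ y, 0 ≤ y → y ≤ ε * S → G y ≤ X
  ge_line : ∀ y, 0 ≤ y → y ≤ ε * s₁ → e + 2 * y ≤ G y
  fold : G (ε * s₁) = X - 2 * γ * (ε * s₁)
  anti : ∀ y z, ε * s₁ ≤ y → y ≤ z → z ≤ ε * S → G z ≤ G y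
  anti_strong : ∀ y z, ε * s₀ ≤ y → y ≤ z → z ≤ ε * S → G z - G y ≤ -(m / ε) * (z - y)
  at_s₀ : G (ε * s₀) = -2 * γ * (ε * s₀)
  ge_s₀ : ∀ y, 0 ≤ y → y ≤ ε * s₀ → -2 * γ * (ε * s₀) ≤ G y
  at_S : G (ε * S) < -r
  neg_lower : ∀ y ≤ 0, -2 * γ * y ≤ G y
  neg_upper : ∀ y ≤ 0, G y ≤ -2 * γ * y + μ * Real.exp (y / ε)
  neg_upper' : ∀ y ≤ 0, G y ≤ -2 * γ * y + e

section

variable {γ μ e X r s₁ s₀ S L m ε : ℝ} {G x y : ℝ → ℝ}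

lemma IsTraj.fst_mono (h : IsTraj G x y) {a b : ℝ} (hab : a ≤ b)
    (hy : ∀ t ∈ Set.Icc a b, 0 ≤ y t) : x a ≤ x b := by
  have := mul_le_sub_of_le_deriv (c := 0) h.1 hab (fun t ht => hy t ⟨ht.1.le, ht.2.le⟩)
  linarith

lemma IsTraj.stay_above (h : IsTraj G x y) {a b l : ℝ} (hl : l ≤ y a)
    (hx : ∀ t ∈ Set.Ico a b, x t < G l) : ∀ t ∈ Set.Icc a b, l ≤ y t := by
  refine fence (f := fun _ => l) (f' := fun _ => 0) (fun t => hasDerivAt_const _ _) h.2 hl ?_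
  intro t ht hlt
  have := hx t ht
  rw [← hlt]
  linarith

lemma IsTraj.stay_below (h : IsTraj G x y) {a b l : ℝ} (hl : y a ≤ l)
    (hx : ∀ t ∈ Set.Ico a b, G l < x t) : ∀ t ∈ Set.Icc a b, y t ≤ l := by
  refine fence (B := fun _ => l) (B' := fun _ => 0) h.2 (fun t => hasDerivAt_const _ _) hl ?_
  intro t ht hlt
  have := hx t ht
  rw [hlt]
  linarith

namespace IsProfile

lemma εs₁_pos (P : IsProfile γ μ e X r s₁ s₀ S L m ε G) : 0 < ε * s₁ :=
  mul_pos P.ε_pos P.s₁_pos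

lemma εs₁_lt (P : IsProfile γ μ e X r s₁ s₀ S L m ε G) : ε * s₁ < ε * s₀ :=
  mul_lt_mul_of_pos_left P.s₁_lt P.ε_pos

lemma εs₀_lt (P : IsProfile γ μ e X r s₁ s₀ S L m ε G) : ε * s₀ < ε * S :=
  mul_lt_mul_of_pos_left P.s₀_lt P.ε_pos

lemma r_pos (P : IsProfile γ μ e X r s₁ s₀ S L m ε G) : 0 < r := by
  linarith [P.e_pos, P.e_lt, P.X_lt]

lemma S_pos (P : IsProfile γ μ e X r s₁ s₀ S L m ε G) : 0 < S := by
  linarith [P.s₁_pos, P.s₁_lt, P.s₀_lt]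

/-- In the upper half plane, `x` increases and `y` stays below `ε S`. -/
lemma upper_bounds (P : IsProfile γ μ e X r s₁ s₀ S L m ε G) (h : IsTraj G x y)
    {b : ℝ} (hx0 : -r ≤ x 0) (hy0 : y 0 ≤ ε * S) (hy : ∀ t ∈ Set.Icc 0 b, 0 ≤ y t) :
    ∀ t ∈ Set.Icc 0 b, x 0 ≤ x t ∧ y t ≤ ε * S := by
  have hx : ∀ t ∈ Set.Icc 0 b, x 0 ≤ x t := fun t ht =>
    h.fst_mono ht.1 (fun s hs => hy s ⟨hs.1, hs.2.trans ht.2⟩)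
  intro t ht
  refine ⟨hx t ht, h.stay_below hy0 (fun s hs => ?_) t ht⟩
  linarith [hx s ⟨hs.1, hs.2.le⟩, P.at_S]

/-- Passage along the slow branch up to the fold. -/
lemma reach_fold (P : IsProfile γ μ e X r s₁ s₀ S L m ε G) (h : IsTraj G x y)
    (hx0 : -r ≤ x 0) (hx1 : x 0 < X - 2 * γ * (ε * s₁)) (hy0 : ε * s₁ ≤ y 0)
    (hy1 : y 0 ≤ ε * S) :
    ∃ T > 0, x T = X - 2 * γ * (ε * s₁) ∧
      ∀ t ∈ Set.Icc 0 T, ε * s₁ ≤ y t ∧ y t ≤ ε * S ∧ x 0 ≤ x t ∧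
        x t ≤ X - 2 * γ * (ε * s₁) := by
  set xf := X - 2 * γ * (ε * s₁) with hxf
  have hp := P.εs₁_pos
  have hev : ∀ᶠ t in nhdsWithin 0 (Set.Ioi (0 : ℝ)), 0 < xf - x t := by
    have : ∀ᶠ t in nhds (0 : ℝ), x t < xf :=
      (h.continuous_fst.tendsto 0).eventually (gt_mem_nhds hx1)
    filter_upwards [this.filter_mono nhdsWithin_le_nhds] with t ht
    linarith
  have hcont : Continuous (fun t => xf - x t) := continuous_const.sub h.continuous_fst
  set C := (xf - x 0) / (ε * s₁) with hC
  have hC0 : 0 < C := div_pos (by linarith) hp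
  rcases pos_or_exists_first_zero hcont hev C with H | ⟨T, hT, hT0, hTlt⟩
  · exfalso
    have hyl := h.stay_above (a := 0) (b := C) hy0 (fun t ht => by
      rw [P.fold]
      rcases eq_or_lt_of_le ht.1 with h0 | h0
      · rw [← h0]; exact hx1
      · linarith [H t ⟨h0, ht.2.le⟩])
    have := mul_le_sub_of_le_deriv h.1 hC0.le (fun t ht => hyl t ⟨ht.1.le, ht.2.le⟩)
    have h2 := H C ⟨hC0, le_rfl⟩
    have h3 : ε * s₁ * (C - 0) = xf - x 0 := by
      rw [hC, sub_zero, mul_div_cancel₀ _ hp.ne']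
    linarith
  · have hlt : ∀ t ∈ Set.Ico 0 T, x t < xf := by
      intro t ht
      rcases eq_or_lt_of_le ht.1 with h0 | h0
      · rw [← h0]; exact hx1
      · linarith [hTlt t ⟨h0, ht.2⟩]
    have hyl := h.stay_above (a := 0) (b := T) hy0 (fun t ht => by
      rw [P.fold]; exact hlt t ht)
    have hub := P.upper_bounds h hx0 hy1 (fun t ht => hp.le.trans (hyl t ht))
    refine ⟨T, hT.1, by linarith, fun t ht => ⟨hyl t ht, (hub t ht).2, (hub t ht).1, ?_⟩⟩
    rcases eq_or_lt_of_le ht.2 with h0 | h0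
    · rw [h0]; linarith
    · exact (hlt t ⟨ht.1, h0⟩).le

/-- Every trajectory entering the upper half plane reaches the fold. -/
lemma reach_fold_of_axis (P : IsProfile γ μ e X r s₁ s₀ S L m ε G) (h : IsTraj G x y)
    (hx0 : -r ≤ x 0) (hx1 : x 0 < e) (hy0 : y 0 = 0)
    (hsm : e + ε * s₁ ≤ X - 2 * γ * (ε * s₁)) :
    ∃ T > 0, x T = X - 2 * γ * (ε * s₁) ∧ ε * s₁ ≤ y T ∧ y T ≤ ε * S := by
  have hp := P.εs₁_pos
  set c := (e - x 0) / 2 with hc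
  have hc0 : 0 < c := by linarith
  have hev : ∀ᶠ t in nhdsWithin 0 (Set.Ioi (0 : ℝ)), 0 < y t := by
    refine eventually_pos_of_hasDerivAt (h.2 0) hy0 ?_
    rw [hy0, P.zero]; linarith
  have hev' : ∀ᶠ t in nhdsWithin 0 (Set.Ioi (0 : ℝ)), 0 < ε * s₁ - y t := by
    have : ∀ᶠ t in nhds (0 : ℝ), y t < ε * s₁ :=
      (h.continuous_snd.tendsto 0).eventually (gt_mem_nhds (by rw [hy0]; exact hp))
    filter_upwards [this.filter_mono nhdsWithin_le_nhds] with t ht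
    linarith
  have grow : ∀ b > 0, (∀ t ∈ Set.Icc 0 b, 0 ≤ y t ∧ y t ≤ ε * s₁) →
      c * b ≤ y b ∧ x b ≤ e + y b - c := by
    intro b hb hyb
    have hx : ∀ t ∈ Set.Icc 0 b, x t - y t ≤ e - c := by
      refine fence (B' := fun _ => 0) (fun t => (h.1 t).sub (h.2 t))
        (fun t => hasDerivAt_const _ _) (by rw [hy0]; linarith) ?_
      intro t ht heq
      have h1 := hyb t ⟨ht.1, ht.2.le⟩
      have h2 := P.ge_line _ h1.1 h1.2
      have heq' : x t - y t = e - c := heq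
      linarith
    have := mul_le_sub_of_le_deriv (c := c) h.2 hb.le (fun t ht => by
      have h1 := hyb t ⟨ht.1.le, ht.2.le⟩
      have h2 := P.ge_line _ h1.1 h1.2
      linarith [hx t ⟨ht.1.le, ht.2.le⟩])
    constructor
    · rw [hy0] at this; linarith
    · linarith [hx b ⟨hb.le, le_rfl⟩]
  have horizon : ∃ C > 0, (∀ t ∈ Set.Icc 0 C, 0 ≤ y t) ∧
      ¬ (∀ t ∈ Set.Ioc 0 C, 0 < ε * s₁ - y t) := by
    set C := ε * s₁ / c with hC
    have hC0 : 0 < C := div_pos hp hc0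
    rcases pos_or_exists_first_zero h.continuous_snd hev C with H | ⟨T, hT, hT0, hTlt⟩
    · have hnn : ∀ t ∈ Set.Icc 0 C, 0 ≤ y t := by
        intro t ht
        rcases eq_or_lt_of_le ht.1 with h0 | h0
        · rw [← h0, hy0]
        · exact (H t ⟨h0, ht.2⟩).le
      refine ⟨C, hC0, hnn, fun hneg => ?_⟩
      have := (grow C hC0 (fun t ht => ⟨hnn t ht, by
        rcases eq_or_lt_of_le ht.1 with h0 | h0
        · rw [← h0, hy0]; exact hp.le
        · linarith [hneg t ⟨h0, ht.2⟩]⟩)).1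
      have h2 := hneg C ⟨hC0, le_rfl⟩
      have h3 : c * C = ε * s₁ := by rw [hC]; field_simp
      linarith
    · have hnn : ∀ t ∈ Set.Icc 0 T, 0 ≤ y t := by
        intro t ht
        rcases eq_or_lt_of_le ht.1 with h0 | h0
        · rw [← h0, hy0]
        · rcases eq_or_lt_of_le ht.2 with h1 | h1
          · rw [h1, hT0]
          · exact (hTlt t ⟨h0, h1⟩).le
      refine ⟨T, hT.1, hnn, fun hneg => ?_⟩
      have := (grow T hT.1 (fun t ht => ⟨hnn t ht, by
        rcases eq_or_lt_of_le ht.1 with h0 | h0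
        · rw [← h0, hy0]; exact hp.le
        · linarith [hneg t ⟨h0, ht.2⟩]⟩)).1
      rw [hT0] at this
      linarith [mul_pos hc0 hT.1]
  obtain ⟨C, hC0, hnn, hC⟩ := horizon
  have hcont : Continuous (fun t => ε * s₁ - y t) := continuous_const.sub h.continuous_snd
  obtain ⟨A, hA, hA0, hAlt⟩ := (pos_or_exists_first_zero hcont hev' C).resolve_left hC
  have hbd : ∀ t ∈ Set.Icc 0 A, 0 ≤ y t ∧ y t ≤ ε * s₁ := by
    intro t ht
    refine ⟨hnn t ⟨ht.1, ht.2.trans hA.2⟩, ?_⟩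
    rcases eq_or_lt_of_le ht.1 with h0 | h0
    · rw [← h0, hy0]; exact hp.le
    · rcases eq_or_lt_of_le ht.2 with h1 | h1
      · rw [h1]; linarith
      · linarith [hAlt t ⟨h0, h1⟩]
  have hg := (grow A hA.1 hbd).2
  have hxA := h.fst_mono hA.1.le (fun t ht => (hbd t ht).1)
  obtain ⟨T, hT, hT1, hT2⟩ := P.reach_fold (h.shift A) (by simp only [zero_add]; linarith)
    (by simp only [zero_add]; linarith) (by simp only [zero_add]; linarith)
    (by simp only [zero_add]; linarith [P.εs₁_lt, P.εs₀_lt])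
  have := hT2 T ⟨hT.le, le_rfl⟩
  exact ⟨T + A, by linarith [hA.1], hT1, this.1, this.2.1⟩

/-- After the fold, the trajectory falls to the horizontal axis near `(X, 0)` in bounded time. -/
lemma exit (P : IsProfile γ μ e X r s₁ s₀ S L m ε G) (h : IsTraj G x y)
    (hx0 : x 0 = X - 2 * γ * (ε * s₁)) (hy0 : ε * s₁ ≤ y 0) (hy1 : y 0 ≤ ε * S)
    (hsm : 2 * γ * (ε * s₁) ≤ (X - e) / 2) :
    ∃ T > 0, T ≤ 2 * (S + L * (2 + S ^ 2 + 2 * γ * s₁)) / (X - e) + 1 ∧ y T = 0 ∧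
      (∀ t ∈ Set.Icc 0 T, 0 ≤ y t ∧ y t ≤ ε * S ∧ X - 2 * γ * (ε * s₁) ≤ x t ∧
        x t ≤ X + ε * (2 + S ^ 2)) := by
  have hp := P.εs₁_pos
  have hε := P.ε_pos
  have hS := P.S_pos
  have hXe : 0 < X - e := by linarith [P.e_lt]
  set C := 2 * (S + L * (2 + S ^ 2 + 2 * γ * s₁)) / (X - e) + 1 with hC
  have hγ := P.γ_pos
  have hL := P.L_pos
  have hs1 := P.s₁_pos
  have hC0 : 0 < C := by positivity
  have bounds : ∀ b, 0 ≤ b → (∀ t ∈ Set.Icc 0 b, 0 ≤ y t) →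
      ∀ t ∈ Set.Icc 0 b, 0 ≤ y t ∧ y t ≤ ε * S ∧ X - 2 * γ * (ε * s₁) ≤ x t ∧
        x t ≤ X + ε * (2 + S ^ 2) := by
    intro b hb hyb
    have hub := P.upper_bounds h (by rw [hx0]; linarith [P.r_pos, P.e_pos]) hy1 hyb
    have hf : ∀ t ∈ Set.Icc 0 b, x t + S * y t ≤ X + ε * (2 + S ^ 2) := by
      refine fence (B' := fun _ => 0) (fun t => (h.1 t).add ((h.2 t).const_mul S))
        (fun t => hasDerivAt_const _ _) ?_ ?_
      · rw [hx0]
        have : 0 < 2 * γ * (ε * s₁) := by positivity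
        nlinarith [mul_le_mul_of_nonneg_left hy1 hS.le]
      · intro t ht heq
        have heq' : x t + S * y t = X + ε * (2 + S ^ 2) := heq
        have h1 := hub t ⟨ht.1, ht.2.le⟩
        have h2 := hyb t ⟨ht.1, ht.2.le⟩
        have h3 := P.le_X _ h2 h1.2
        have h4 : S * y t ≤ S * (ε * S) := mul_le_mul_of_nonneg_left h1.2 hS.le
        have h5 : S * (-x t + G (y t)) ≤ S * (-(2 * ε)) := by
          apply mul_le_mul_of_nonneg_left _ hS.le
          nlinarith
        have : 0 < ε * S := by positivity
        nlinarith
    intro t ht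
    have h1 := hub t ht
    have h2 := hyb t ht
    refine ⟨h2, h1.2, hx0 ▸ h1.1, ?_⟩
    linarith [hf t ht, mul_nonneg hS.le h2]
  have hev : ∀ᶠ t in nhdsWithin 0 (Set.Ioi (0 : ℝ)), 0 < y t := by
    have : ∀ᶠ t in nhds (0 : ℝ), 0 < y t :=
      (h.continuous_snd.tendsto 0).eventually (lt_mem_nhds (hp.trans_le hy0))
    exact this.filter_mono nhdsWithin_le_nhds
  rcases pos_or_exists_first_zero h.continuous_snd hev C with H | ⟨T, hT, hT0, hTlt⟩
  · exfalso
    have hnn : ∀ t ∈ Set.Icc 0 C, 0 ≤ y t := by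
      intro t ht
      rcases eq_or_lt_of_le ht.1 with h0 | h0
      · rw [← h0]; linarith
      · exact (H t ⟨h0, ht.2⟩).le
    have hb := bounds C hC0.le hnn
    have hW := sub_le_mul_of_deriv_le (c := -((X - e) / 2))
      (fun t => (h.2 t).sub ((h.1 t).const_mul (L / ε))) hC0.le (fun t ht => by
        have h1 := hb t ⟨ht.1.le, ht.2.le⟩
        have h2 := P.lip _ h1.2.1 0 (by positivity)
        rw [P.zero, sub_zero, abs_of_nonneg h1.1] at h2
        linarith [(abs_le.1 h2).2])
    have h0 := hb 0 ⟨le_rfl, hC0.le⟩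
    have h1 := hb C ⟨hC0.le, le_rfl⟩
    simp only [Pi.sub_apply] at hW
    have h2 : L / ε * (x C - x 0) ≤ L * (2 + S ^ 2 + 2 * γ * s₁) := by
      have : L / ε * (x C - x 0) ≤ L / ε * (ε * (2 + S ^ 2 + 2 * γ * s₁)) := by
        apply mul_le_mul_of_nonneg_left _ (by positivity)
        rw [hx0]; linarith [h1.2.2.2]
      refine this.trans (le_of_eq ?_)
      field_simp
    have h3 : (X - e) / 2 * C = S + L * (2 + S ^ 2 + 2 * γ * s₁) + (X - e) / 2 := by
      rw [hC]; field_simp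
    have h4 : ε * S ≤ 1 * S := mul_le_mul_of_nonneg_right P.ε_le hS.le
    nlinarith [h1.1]
  · refine ⟨T, hT.1, hT.2, hT0, bounds T hT.1.le ?_⟩
    intro t ht
    rcases eq_or_lt_of_le ht.1 with h0 | h0
    · rw [← h0]; linarith
    · rcases eq_or_lt_of_le ht.2 with h1 | h1
      · rw [h1, hT0]
      · exact (hTlt t ⟨h0, h1⟩).le

/-- A trajectory entering the upper half plane at the far left climbs to the slow branch. -/
lemma climb (P : IsProfile γ μ e X r s₁ s₀ S L m ε G) (h : IsTraj G x y) {D C : ℝ} (hC : 0 ≤ C)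
    (hx0 : -r ≤ x 0) (hx1 : x 0 ≤ 3 * D / 4) (hy0 : y 0 = 0)
    (hsm : ε * S * C ≤ -D / 4) (hsm' : 2 * γ * (ε * s₀) ≤ -D / 8)
    (hsm'' : ε * s₀ ≤ -D / 4) :
    (∀ t ∈ Set.Icc 0 C, 0 ≤ y t ∧ y t ≤ ε * S ∧ x 0 ≤ x t ∧ x t ≤ D / 2) ∧
      ∀ t ∈ Set.Icc 1 C, ε * s₀ ≤ y t := by
  have hp : 0 < ε * s₀ := P.εs₁_pos.trans P.εs₁_lt
  have hε := P.ε_pos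
  have hS := P.S_pos
  have hev : ∀ᶠ t in nhdsWithin 0 (Set.Ioi (0 : ℝ)), 0 < y t := by
    refine eventually_pos_of_hasDerivAt (h.2 0) hy0 ?_
    rw [hy0, P.zero]; linarith [P.e_pos]
  have bounds : ∀ b, 0 ≤ b → b ≤ C → (∀ t ∈ Set.Icc 0 b, 0 ≤ y t) →
      ∀ t ∈ Set.Icc 0 b, 0 ≤ y t ∧ y t ≤ ε * S ∧ x 0 ≤ x t ∧ x t ≤ D / 2 := by
    intro b hb hbC hyb t ht
    have hub := P.upper_bounds h hx0 (by rw [hy0]; positivity) hyb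
    refine ⟨hyb t ht, (hub t ht).2, (hub t ht).1, ?_⟩
    have := sub_le_mul_of_deriv_le h.1 ht.1
      (fun s hs => (hub s ⟨hs.1.le, hs.2.le.trans ht.2⟩).2)
    have h2 : ε * S * (t - 0) ≤ ε * S * C :=
      mul_le_mul_of_nonneg_left (by linarith [ht.2]) (by positivity)
    linarith
  have grow : ∀ b, 0 ≤ b → b ≤ C → -D / 4 * b ≤ ε * s₀ → (∀ t ∈ Set.Icc 0 b, 0 ≤ y t) →
      ∀ t ∈ Set.Icc 0 b, -D / 4 * t ≤ y t := by
    intro b hb hbC hb0 hyb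
    have hbd := bounds b hb hbC hyb
    refine fence (f := fun t => -D / 4 * t) (f' := fun _ => -D / 4)
      (fun t => by simpa using (hasDerivAt_id t).const_mul (-D / 4)) h.2 (by simp [hy0]) ?_
    intro t ht heq
    have h1 := hbd t ⟨ht.1, ht.2.le⟩
    have h2 : y t ≤ ε * s₀ := by
      rw [← heq]
      exact (mul_le_mul_of_nonneg_left ht.2.le (by linarith)).trans hb0
    have h3 := P.ge_s₀ _ h1.1 h2
    linarith [h1.2.2.2]
  have hbase : ε * s₀ / (-D / 4) ≤ 1 := by
    rw [div_le_one (by linarith)]; exact hsm''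
  have hb0 : 0 < ε * s₀ / (-D / 4) := div_pos hp (by linarith)
  have late : ∀ b, b ≤ C → (∀ t ∈ Set.Icc 0 b, 0 ≤ y t) → ε * s₀ / (-D / 4) ≤ b →
      ∀ t ∈ Set.Icc (ε * s₀ / (-D / 4)) b, ε * s₀ ≤ y t := by
    intro b hbC hyb hbb
    have hb1 := grow (ε * s₀ / (-D / 4)) hb0.le (hbb.trans hbC)
      (by rw [mul_div_cancel₀]; linarith) (fun t ht => hyb t ⟨ht.1, ht.2.trans hbb⟩)
      _ ⟨hb0.le, le_rfl⟩
    rw [mul_div_cancel₀ _ (by linarith)] at hb1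
    refine h.stay_above hb1 (fun t ht => ?_)
    rw [P.at_s₀]
    have := (bounds b (hb0.le.trans hbb) hbC hyb t ⟨hb0.le.trans ht.1, ht.2.le⟩).2.2.2
    linarith
  have hnn : ∀ t ∈ Set.Icc 0 C, 0 ≤ y t := by
    rcases pos_or_exists_first_zero h.continuous_snd hev C with H | ⟨T, hT, hT0, hTlt⟩
    · intro t ht
      rcases eq_or_lt_of_le ht.1 with h0 | h0
      · rw [← h0, hy0]
      · exact (H t ⟨h0, ht.2⟩).le
    · exfalso
      have hnn : ∀ t ∈ Set.Icc 0 T, 0 ≤ y t := by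
        intro t ht
        rcases eq_or_lt_of_le ht.1 with h0 | h0
        · rw [← h0, hy0]
        · rcases eq_or_lt_of_le ht.2 with h1 | h1
          · rw [h1, hT0]
          · exact (hTlt t ⟨h0, h1⟩).le
      rcases le_total (ε * s₀ / (-D / 4)) T with hc | hc
      · have := late T hT.2 hnn hc T ⟨hc, le_rfl⟩
        linarith
      · have h1 : -D / 4 * T ≤ ε * s₀ := by
          rwa [le_div_iff₀ (by linarith), mul_comm] at hc
        have := grow T hT.1.le hT.2 h1 hnn T ⟨hT.1.le, le_rfl⟩
        have h2 : 0 < -D / 4 * T := mul_pos (by linarith) hT.1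
        linarith
  exact ⟨bounds C hC le_rfl hnn, fun t ht => late C le_rfl hnn (by linarith [ht.1, ht.2])
    t ⟨hbase.trans ht.1, ht.2⟩⟩

end IsProfile

end

/-- `(a, b)` solves the linear system `ẋ = y`, `ẏ = -x - 2γy`, starts at `(X, 0)`, and returns to
the horizontal axis at `(D, 0)` at time `τ` through the lower half plane. -/
structure IsLinArc (γ X τ D : ℝ) (a b : ℝ → ℝ) : Prop where
  τ_pos : 0 < τ
  D_neg : D < 0
  deriv_fst : ∀ t, HasDerivAt a (b t) t
  deriv_snd : ∀ t, HasDerivAt b (-a t - 2 * γ * b t) t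
  fst_zero : a 0 = X
  snd_zero : b 0 = 0
  fst_τ : a τ = D
  snd_τ : b τ = 0
  neg : ∀ t ∈ Set.Ioo 0 τ, b t < 0
  abs_fst_le : ∀ t, 0 ≤ t → |a t| ≤ X
  abs_snd_le : ∀ t, 0 ≤ t → |b t| ≤ X

lemma eq_of_linear_flow {γ : ℝ} {u v : ℝ → ℝ × ℝ}
    (hu : ∀ t, HasDerivAt u ((u t).2, -(u t).1 - 2 * γ * (u t).2) t)
    (hv : ∀ t, HasDerivAt v ((v t).2, -(v t).1 - 2 * γ * (v t).2) t) (h0 : u 0 = v 0) : u = v := by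
  let A : ℝ × ℝ →L[ℝ] ℝ × ℝ :=
    (ContinuousLinearMap.snd ℝ ℝ ℝ).prod
      (-(ContinuousLinearMap.fst ℝ ℝ ℝ) - (2 * γ) • ContinuousLinearMap.snd ℝ ℝ ℝ)
  have hA : ∀ p : ℝ × ℝ, A p = (p.2, -p.1 - 2 * γ * p.2) := fun p => by simp [A]
  refine ODE_solution_unique_univ (v := fun _ => A) (s := fun _ => Set.univ) (t₀ := 0)
    (K := ‖A‖₊) (fun _ => A.lipschitz.lipschitzOnWith) (fun t => ⟨?_, trivial⟩)
    (fun t => ⟨?_, trivial⟩) h0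
  · rw [hA]; exact hu t
  · rw [hA]; exact hv t

lemma isLinArc_of_flow {γ X ω D : ℝ} (hγ : γ ∈ Set.Ioo (0 : ℝ) 1) (hX : 0 < X)
    (hω : ω = Real.sqrt (1 - γ ^ 2)) (hD : D = -X * Real.exp (-γ * Real.pi / ω))
    {u : ℝ → ℝ × ℝ} (hu : ∀ t, HasDerivAt u ((u t).2, -(u t).1 - 2 * γ * (u t).2) t)
    (hu0 : u 0 = (X, 0)) :
    IsLinArc γ X (Real.pi / ω) D (fun t => (u t).1) (fun t => (u t).2) := by
  have hγ0 := hγ.1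
  have hγ1 : 0 < 1 - γ ^ 2 := by nlinarith [hγ.1, hγ.2]
  have hω0 : 0 < ω := hω ▸ Real.sqrt_pos.2 hγ1
  have hω2 : ω ^ 2 = 1 - γ ^ 2 := by rw [hω, Real.sq_sqrt hγ1.le]
  have h1 : ∀ t, HasDerivAt (fun t => (u t).1) ((u t).2) t := fun t => (hu t).fst
  have h2 : ∀ t, HasDerivAt (fun t => (u t).2) (-(u t).1 - 2 * γ * (u t).2) t :=
    fun t => (hu t).snd
  let v : ℝ → ℝ × ℝ := fun t =>
    (X * (Real.exp (-γ * t) * (Real.cos (ω * t) + γ / ω * Real.sin (ω * t))),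
      -(X / ω) * (Real.exp (-γ * t) * Real.sin (ω * t)))
  have huv : u = v := by
    refine eq_of_linear_flow hu (fun t => ?_) (by simp [v, hu0])
    have he : HasDerivAt (fun t => Real.exp (-γ * t)) (Real.exp (-γ * t) * -γ) t := by
      simpa using ((hasDerivAt_id t).const_mul (-γ)).exp
    have hid : HasDerivAt (fun t => ω * t) ω t := by
      simpa using (hasDerivAt_id t).const_mul ω
    have hs := hid.sin
    have hc := hid.cos
    refine ((he.mul (hc.add (hs.const_mul (γ / ω)))).const_mul X).prodMk
      ((he.mul hs).const_mul (-(X / ω))) |>.congr_deriv ?_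
    simp only [v, Prod.mk.injEq]
    constructor
    · simp only [Pi.add_apply]
      field_simp
      linear_combination (-Real.sin (t * ω)) * hω2
    · field_simp
      ring
  have hπ : ω * (Real.pi / ω) = Real.pi := by field_simp
  have hen : ∀ t, 0 ≤ t → (u t).1 ^ 2 + (u t).2 ^ 2 ≤ X ^ 2 := by
    intro t ht
    have := sub_le_mul_of_deriv_le (c := 0) (fun t => ((h1 t).pow 2).add ((h2 t).pow 2)) ht
      (fun s hs => by
        simp only [Nat.cast_ofNat, Nat.add_one_sub_one, pow_one]
        nlinarith [mul_nonneg hγ0.le (sq_nonneg (u s).2)])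
    simp only [Pi.add_apply, Pi.pow_apply, hu0] at this
    linarith
  refine ⟨by positivity, ?_, h1, h2, by simp [hu0], by simp [hu0], ?_, ?_, ?_, ?_, ?_⟩
  · rw [hD]
    have := Real.exp_pos (-γ * Real.pi / ω)
    nlinarith
  · simp only [huv, v, hπ, Real.cos_pi, Real.sin_pi, hD]
    rw [mul_div_assoc (-γ)]
    ring
  · simp [huv, v, hπ]
  · intro t ht
    have hs : 0 < Real.sin (ω * t) := by
      refine Real.sin_pos_of_pos_of_lt_pi (mul_pos hω0 ht.1) ?_
      rw [← hπ]
      exact mul_lt_mul_of_pos_left ht.2 hω0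
    have : 0 < X / ω * (Real.exp (-γ * t) * Real.sin (ω * t)) := by positivity
    simp only [huv, v]
    linarith
  · intro t ht
    exact abs_le_of_sq_le_sq (by nlinarith [hen t ht, sq_nonneg (u t).2]) hX.le
  · intro t ht
    exact abs_le_of_sq_le_sq (by nlinarith [hen t ht, sq_nonneg (u t).1]) hX.le

namespace IsLinArc

variable {γ X τ D : ℝ} {a b : ℝ → ℝ}

lemma continuous_fst (A : IsLinArc γ X τ D a b) : Continuous a :=
  continuous_iff_continuousAt.2 fun t => (A.deriv_fst t).continuousAt

lemma continuous_snd (A : IsLinArc γ X τ D a b) : Continuous b :=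
  continuous_iff_continuousAt.2 fun t => (A.deriv_snd t).continuousAt

/-- Away from the end point, the arc is either well below the axis or to the right of `c`. -/
lemma exists_gap (A : IsLinArc γ X τ D a b) {c σ : ℝ} (hc : c < X) (hσ : σ < τ) :
    ∃ η > 0, ∀ t ∈ Set.Icc 0 σ, b t ≤ -η ∨ c ≤ a t := by
  have hev : ∀ᶠ t in nhds (0 : ℝ), c < a t :=
    (A.continuous_fst.tendsto 0).eventually (lt_mem_nhds (by rw [A.fst_zero]; exact hc))
  obtain ⟨d, hd, hda⟩ := Metric.eventually_nhds_iff.1 hev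
  rcases le_or_gt (d / 2) σ with h | h
  · obtain ⟨t₀, ht₀, hmax⟩ := isCompact_Icc.exists_isMaxOn (Set.nonempty_Icc.2 h)
      A.continuous_snd.continuousOn
    refine ⟨-b t₀, neg_pos.2 (A.neg t₀ ⟨by linarith [ht₀.1], by linarith [ht₀.2]⟩), ?_⟩
    intro t ht
    rcases le_or_gt (d / 2) t with h' | h'
    · left
      rw [neg_neg]
      exact hmax ⟨h', ht.2⟩
    · right
      refine (hda ?_).le
      rw [Real.dist_eq, sub_zero, abs_of_nonneg ht.1]
      linarith
  · refine ⟨1, one_pos, fun t ht => Or.inr (hda ?_).le⟩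
    rw [Real.dist_eq, sub_zero, abs_of_nonneg ht.1]
    linarith [ht.2]

/-- Near the end of the arc. -/
lemma exists_near_end (A : IsLinArc γ X τ D a b) {δ : ℝ} (hδ : 0 < δ) :
    ∃ σ, 0 < σ ∧ σ < τ ∧ τ - σ ≤ δ ∧ ∀ t ∈ Set.Icc σ τ, |a t - D| ≤ δ ∧ |b t| ≤ δ := by
  have h1 : ∀ᶠ t in nhds τ, |a t - D| < δ := by
    have : Continuous fun t => |a t - D| := (A.continuous_fst.sub continuous_const).abs
    exact (this.tendsto τ).eventually (gt_mem_nhds (by simpa [A.fst_τ] using hδ))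
  have h2 : ∀ᶠ t in nhds τ, |b t| < δ :=
    (A.continuous_snd.abs.tendsto τ).eventually (gt_mem_nhds (by simpa [A.snd_τ] using hδ))
  obtain ⟨d, hd, hda⟩ := Metric.eventually_nhds_iff.1 (h1.and h2)
  have hτ := A.τ_pos
  have hm : 0 < min (d / 2) (min (τ / 2) δ) := lt_min (by linarith) (lt_min (by linarith) hδ)
  have hm1 := min_le_left (d / 2) (min (τ / 2) δ)
  have hm2 := (min_le_right (d / 2) (min (τ / 2) δ)).trans (min_le_left _ _)
  have hm3 := (min_le_right (d / 2) (min (τ / 2) δ)).trans (min_le_right _ _)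
  refine ⟨τ - min (d / 2) (min (τ / 2) δ), by linarith, by linarith, by linarith, ?_⟩
  intro t ht
  have : dist t τ < d := by
    rw [Real.dist_eq, abs_sub_comm, abs_of_nonneg (by linarith [ht.2])]
    linarith [ht.1]
  exact ⟨(hda this).1.le, (hda this).2.le⟩

end IsLinArc

namespace IsProfile

variable {γ μ e X r s₁ s₀ S L m ε : ℝ} {G x y a b : ℝ → ℝ} {τ D : ℝ}

/-- In the lower half plane, a trajectory follows the linear flow. -/
lemma track (P : IsProfile γ μ e X r s₁ s₀ S L m ε G) (A : IsLinArc γ X τ D a b)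
    (h : IsTraj G x y) {δ η c σ : ℝ} (hδ : 0 < δ) (hδ1 : δ ≤ 1) (hδη : δ ≤ η) (hδc : δ ≤ c)
    (hηc : 2 * γ * η ≤ c) (hgap : ∀ t ∈ Set.Icc 0 σ, b t ≤ -(2 * η) ∨ e + 3 * c ≤ a t)
    (hy0 : y 0 = 0)
    (hsmall : (1 + (x 0 - X) ^ 2) * Real.exp (μ * ε / c +
      (μ * ((X + 1 + 2 * γ * (X + 1) + e) / c + 1) * Real.exp (-η / ε) + ε) * σ) ≤ 1 + δ ^ 2)
    {T : ℝ} (hT : T ≤ σ) (hy : ∀ t ∈ Set.Icc 0 T, y t ≤ 0) :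
    ∀ t ∈ Set.Icc 0 T, |x t - a t| ≤ δ ∧ |y t - b t| ≤ δ ∧
      (y t ≤ -η ∨ -x t + G (y t) ≤ -c) := by
  have hε := P.ε_pos
  have hμ := P.μ_pos
  have hγ := P.γ_pos
  have he := P.e_pos
  have hX := P.e_lt
  have hc : 0 < c := hδ.trans_le hδc
  have hη : 0 < η := hδ.trans_le hδη
  set M := X + 1 + 2 * γ * (X + 1) + e with hM
  have hM0 : 0 < M := by have : 0 < X := he.trans hX; positivity
  set Q := μ * (M / c + 1) * Real.exp (-η / ε) + ε with hQ
  have hQ0 : 0 < Q := by positivity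
  set N0 := (x 0 - X) ^ 2 with hN0
  have hN0' : 0 ≤ N0 := sq_nonneg _
  have near : ∀ t ∈ Set.Icc 0 T, (x t - a t) ^ 2 + (y t - b t) ^ 2 ≤ δ ^ 2 →
      |x t - a t| ≤ δ ∧ |y t - b t| ≤ δ ∧ (y t ≤ -η ∨ -x t + G (y t) ≤ -c) := by
    intro t ht hN
    have h1 : |x t - a t| ≤ δ :=
      abs_le_of_sq_le_sq (by nlinarith [sq_nonneg (y t - b t)]) hδ.le
    have h2 : |y t - b t| ≤ δ :=
      abs_le_of_sq_le_sq (by nlinarith [sq_nonneg (x t - a t)]) hδ.le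
    refine ⟨h1, h2, ?_⟩
    rcases hgap t ⟨ht.1, ht.2.trans hT⟩ with hb | ha
    · left
      linarith [(abs_le.1 h2).2]
    · rcases le_or_gt (y t) (-η) with h3 | h3
      · exact Or.inl h3
      · right
        have h4 := P.neg_upper' _ (hy t ht)
        have h5 : 2 * γ * (-y t) ≤ 2 * γ * η :=
          mul_le_mul_of_nonneg_left (by linarith) (by positivity)
        linarith [(abs_le.1 h1).1]
  have hNd : ∀ t, HasDerivAt (fun t => (x t - a t) ^ 2 + (y t - b t) ^ 2)
      (2 * (x t - a t) * (y t - b t) +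
        2 * (y t - b t) * (-x t + G (y t) - (-a t - 2 * γ * b t))) t := fun t => by
    refine ((((h.1 t).sub (A.deriv_fst t)).pow 2).add
      (((h.2 t).sub (A.deriv_snd t)).pow 2)).congr_deriv ?_
    simp
  have hH : ∀ t, HasDerivAt (fun t => -(μ * ε / c) * Real.exp (y t / ε) + Q * t + μ * ε / c)
      (-(μ / c) * Real.exp (y t / ε) * (-x t + G (y t)) + Q) t := fun t => by
    refine (((((h.2 t).div_const ε).exp.const_mul (-(μ * ε / c))).add
      ((hasDerivAt_id t).const_mul Q)).add_const (μ * ε / c)).congr_deriv ?_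
    field_simp
  have hBle : ∀ t ∈ Set.Icc 0 T, (1 + N0) * Real.exp (-(μ * ε / c) * Real.exp (y t / ε) + Q * t
      + μ * ε / c) - 1 ≤ δ ^ 2 := by
    intro t ht
    have h1 : 0 ≤ μ * ε / c * Real.exp (y t / ε) := by positivity
    have h2 : Q * t ≤ Q * σ := mul_le_mul_of_nonneg_left (ht.2.trans hT) hQ0.le
    have : (1 + N0) * Real.exp (-(μ * ε / c) * Real.exp (y t / ε) + Q * t + μ * ε / c) ≤
        (1 + N0) * Real.exp (μ * ε / c + Q * σ) := by
      apply mul_le_mul_of_nonneg_left _ (by linarith)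
      apply Real.exp_le_exp.2
      linarith
    linarith
  have hNB : ∀ t ∈ Set.Icc 0 T, (x t - a t) ^ 2 + (y t - b t) ^ 2 ≤
      (1 + N0) * Real.exp (-(μ * ε / c) * Real.exp (y t / ε) + Q * t + μ * ε / c) - 1 := by
    refine fence hNd (fun t => (((hH t).exp.const_mul (1 + N0)).sub_const 1)) ?_ ?_
    · rw [hy0, A.fst_zero, A.snd_zero, zero_div, Real.exp_zero]
      simp [hN0]
    · intro t ht heq
      have ht' : t ∈ Set.Icc 0 T := ⟨ht.1, ht.2.le⟩
      obtain ⟨h1, h2, h3⟩ := near t ht' (heq ▸ hBle t ht')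
      have hyt := hy t ht'
      set E := Real.exp (-(μ * ε / c) * Real.exp (y t / ε) + Q * t + μ * ε / c) with hE
      have hEN : (1 + N0) * E = 1 + ((x t - a t) ^ 2 + (y t - b t) ^ 2) := by linarith
      set g := G (y t) + 2 * γ * y t with hg
      have hg0 : 0 ≤ g := by linarith [P.neg_lower _ hyt]
      have hg1 : g ≤ μ * Real.exp (y t / ε) := by linarith [P.neg_upper _ hyt]
      set z := Real.exp (y t / ε) with hz
      have hz0 : 0 < z := Real.exp_pos _
      have hQg : g < -(μ / c) * z * (-x t + G (y t)) + Q := by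
        rcases h3 with h3 | h3
        · have hzη : z ≤ Real.exp (-η / ε) :=
            Real.exp_le_exp.2 (div_le_div_of_nonneg_right h3 hε.le)
          have hxM : -x t + G (y t) ≤ M := by
            have h4 := P.neg_upper' _ hyt
            have h5 := abs_le.1 (A.abs_fst_le t ht.1)
            have h6 := abs_le.1 (A.abs_snd_le t ht.1)
            have h7 : 2 * γ * (-y t) ≤ 2 * γ * (X + 1) :=
              mul_le_mul_of_nonneg_left (by linarith [(abs_le.1 h2).1]) (by positivity)
            linarith [(abs_le.1 h1).1]
          have h8 : μ / c * z * (-x t + G (y t)) ≤ μ / c * z * M :=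
            mul_le_mul_of_nonneg_left hxM (by positivity)
          have h9 : (μ / c * M + μ) * z ≤ (μ / c * M + μ) * Real.exp (-η / ε) :=
            mul_le_mul_of_nonneg_left hzη (by positivity)
          have h10 : Q = (μ / c * M + μ) * Real.exp (-η / ε) + ε := by
            rw [hQ]; ring
          linarith
        · have h8 : μ / c * z * c ≤ μ / c * z * (-(-x t + G (y t))) :=
            mul_le_mul_of_nonneg_left (by linarith) (by positivity)
          have h9 : μ / c * z * c = μ * z := by field_simp
          linarith
      have hfin : 2 * (x t - a t) * (y t - b t) +
          2 * (y t - b t) * (-x t + G (y t) - (-a t - 2 * γ * b t)) ≤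
          g * (1 + ((x t - a t) ^ 2 + (y t - b t) ^ 2)) := by
        have : 2 * (x t - a t) * (y t - b t) +
          2 * (y t - b t) * (-x t + G (y t) - (-a t - 2 * γ * b t)) =
          2 * (y t - b t) * g - 4 * γ * (y t - b t) ^ 2 := by rw [hg]; ring
        rw [this]
        nlinarith [mul_nonneg hg0 (sq_nonneg (y t - b t - 1)),
          mul_nonneg hg0 (sq_nonneg (x t - a t)), mul_nonneg hγ.le (sq_nonneg (y t - b t))]
      refine hfin.trans_lt ?_
      rw [← mul_assoc, hEN, mul_comm g]
      exact mul_lt_mul_of_pos_left hQg (by positivity)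
  exact fun t ht => near t ht ((hNB t ht).trans (hBle t ht))

end IsProfile

lemma eventually_track_small {μ c η σ δ K M : ℝ} (hη : 0 < η) (hδ : 0 < δ) :
    ∀ᶠ ε in nhdsWithin 0 (Set.Ioi (0 : ℝ)), (1 + (ε * K) ^ 2) * Real.exp (μ * ε / c +
      (μ * (M / c + 1) * Real.exp (-η / ε) + ε) * σ) ≤ 1 + δ ^ 2 := by
  have hid : Filter.Tendsto (fun ε : ℝ => ε) (nhdsWithin 0 (Set.Ioi (0 : ℝ))) (nhds 0) :=
    Filter.tendsto_id.mono_left nhdsWithin_le_nhds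
  have hexp : Filter.Tendsto (fun ε : ℝ => Real.exp (-η / ε))
      (nhdsWithin 0 (Set.Ioi (0 : ℝ))) (nhds 0) := by
    refine Real.tendsto_exp_atBot.comp ?_
    exact tendsto_inv_nhdsGT_zero.const_mul_atTop_of_neg (neg_lt_zero.2 hη)
  have h1 : Filter.Tendsto (fun ε : ℝ => (1 + (ε * K) ^ 2) * Real.exp (μ * ε / c +
      (μ * (M / c + 1) * Real.exp (-η / ε) + ε) * σ)) (nhdsWithin 0 (Set.Ioi (0 : ℝ)))
      (nhds ((1 + (0 * K) ^ 2) * Real.exp (μ * 0 / c +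
      (μ * (M / c + 1) * 0 + 0) * σ))) := by
    refine (tendsto_const_nhds.add ((hid.mul_const K).pow 2)).mul
      ((Real.continuous_exp.tendsto _).comp ?_)
    exact ((hid.const_mul μ).div_const c).add (((hexp.const_mul _).add hid).mul_const σ)
  have h2 : ((1 + (0 * K) ^ 2) * Real.exp (μ * 0 / c +
      (μ * (M / c + 1) * 0 + 0) * σ)) < 1 + δ ^ 2 := by
    simp; positivity
  exact (h1.eventually (gt_mem_nhds h2)).mono fun _ h => h.le

/-- The passage through the lower half plane follows the arc of the linear flow. -/
lemma eventually_lower_arc {γ μ e X τ D : ℝ} {a b : ℝ → ℝ} (r s₁ s₀ S L m : ℝ)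
    (A : IsLinArc γ X τ D a b) (hγ : 0 < γ) (heX : e < X) (K : ℝ) {δ : ℝ} (hδ : 0 < δ) :
    ∀ᶠ ε in nhdsWithin 0 (Set.Ioi (0 : ℝ)), ∀ G,
      IsProfile γ μ e X r s₁ s₀ S L m ε G → ∀ x y, IsTraj G x y → y 0 = 0 →
      |x 0 - X| ≤ ε * K →
      ∃ T > 0, T ≤ τ + 1 ∧ y T = 0 ∧ |x T - D| ≤ δ ∧
        (∀ t ∈ Set.Icc 0 T, y t ≤ 0 ∧ ∃ s ∈ Set.Icc 0 τ, |x t - a s| ≤ δ ∧ |y t - b s| ≤ δ) ∧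
        (∀ s ∈ Set.Icc 0 τ, ∃ t ∈ Set.Icc 0 T, |x t - a s| ≤ δ ∧ |y t - b s| ≤ δ) := by
  have hD := A.D_neg
  obtain ⟨δ₁, hδ₁, h8, h1, h4⟩ : ∃ δ₁ > 0, 8 * δ₁ ≤ δ ∧ δ₁ ≤ 1 ∧ 4 * δ₁ ≤ -D :=
    ⟨min (δ / 8) (min 1 (-D / 4)), lt_min (by linarith) (lt_min one_pos (by linarith)),
      by linarith [min_le_left (δ / 8) (min 1 (-D / 4))],
      (min_le_right _ _).trans (min_le_left _ _),
      by linarith [(min_le_right (δ / 8) (min 1 (-D / 4))).trans (min_le_right _ _)]⟩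
  obtain ⟨σ, hσ0, hστ, hστ', hend⟩ := A.exists_near_end hδ₁
  set c := (X - e) / 6 with hc
  have hc0 : 0 < c := by linarith
  obtain ⟨η', hη', hgap'⟩ := A.exists_gap (c := e + 3 * c) (by linarith) hστ
  obtain ⟨η, hη, hηη, hηc⟩ : ∃ η > 0, 2 * η ≤ η' ∧ 2 * γ * η ≤ c := by
    refine ⟨min (η' / 2) (c / (2 * γ)), lt_min (by linarith) (by positivity),
      by linarith [min_le_left (η' / 2) (c / (2 * γ))], ?_⟩
    calc 2 * γ * min (η' / 2) (c / (2 * γ)) ≤ 2 * γ * (c / (2 * γ)) :=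
          mul_le_mul_of_nonneg_left (min_le_right _ _) (by positivity)
      _ = c := by field_simp
  have hgap : ∀ t ∈ Set.Icc 0 σ, b t ≤ -(2 * η) ∨ e + 3 * c ≤ a t := fun t ht =>
    (hgap' t ht).imp (fun h => by linarith) id
  obtain ⟨δ₂, hδ₂, h21, h2η, h2c⟩ : ∃ δ₂ > 0, δ₂ ≤ δ₁ ∧ δ₂ ≤ η ∧ δ₂ ≤ c :=
    ⟨min δ₁ (min η c), lt_min hδ₁ (lt_min hη hc0), min_le_left _ _,
      (min_le_right _ _).trans (min_le_left _ _), (min_le_right _ _).trans (min_le_right _ _)⟩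
  filter_upwards [eventually_track_small (μ := μ) (c := c) (σ := σ) (K := K)
    (M := X + 1 + 2 * γ * (X + 1) + e) hη hδ₂] with ε hsm G P x y h hy0 hx0
  have hsmall : (1 + (x 0 - X) ^ 2) * Real.exp (μ * ε / c +
      (μ * ((X + 1 + 2 * γ * (X + 1) + e) / c + 1) * Real.exp (-η / ε) + ε) * σ)
      ≤ 1 + δ₂ ^ 2 := by
    refine le_trans (mul_le_mul_of_nonneg_right ?_ (Real.exp_pos _).le) hsm
    have := sq_le_sq' (by linarith [neg_abs_le (x 0 - X)]) ((le_abs_self _).trans hx0)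
    linarith
  have trk := fun {T : ℝ} (hT : T ≤ σ) =>
    P.track A h hδ₂ (h21.trans h1) h2η h2c hηc hgap hy0 hsmall hT
  have hneg0 : -x 0 + G (y 0) ≤ -c := by
    refine (trk hσ0.le (fun t ht => ?_) 0 ⟨le_rfl, le_rfl⟩).2.2.resolve_left ?_
    · rw [le_antisymm ht.2 ht.1, hy0]
    · rw [hy0]; linarith
  have hcont : Continuous fun t => -y t := h.continuous_snd.neg
  have hev : ∀ᶠ t in nhdsWithin 0 (Set.Ioi (0 : ℝ)), 0 < -y t :=
    eventually_pos_of_hasDerivAt (h.2 0).neg (by simp [hy0]) (by linarith)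
  have hneg : ∀ t ∈ Set.Ioc 0 σ, 0 < -y t := by
    refine (pos_or_exists_first_zero hcont hev σ).resolve_right ?_
    rintro ⟨T, hT, hT0, hTlt⟩
    have hyT : y T = 0 := by linarith
    have h3 := (trk hT.2 (fun t ht => by
      rcases eq_or_lt_of_le ht.1 with h0 | h0
      · rw [← h0, hy0]
      · rcases eq_or_lt_of_le ht.2 with h1 | h1
        · rw [h1, hyT]
        · linarith [hTlt t ⟨h0, h1⟩]) T ⟨hT.1.le, le_rfl⟩).2.2.resolve_left
          (by rw [hyT]; linarith)
    have hd : HasDerivAt (fun s => y (T - s)) (-(-x T + G (y T))) 0 := by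
      have := (h.2 (T - 0)).comp_const_sub T 0
      simpa using this
    have hev2 := eventually_pos_of_hasDerivAt hd (by simp [hyT]) (by linarith)
    have hev3 : ∀ᶠ s in nhdsWithin 0 (Set.Ioi (0 : ℝ)), s < T :=
      (gt_mem_nhds hT.1).filter_mono nhdsWithin_le_nhds
    obtain ⟨s, hs1, hs2, hs3⟩ := (hev2.and (hev3.and self_mem_nhdsWithin)).exists
    have hs3' : (0 : ℝ) < s := hs3
    linarith [hTlt (T - s) ⟨by linarith, by linarith⟩]
  have hnp : ∀ t ∈ Set.Icc 0 σ, y t ≤ 0 := by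
    intro t ht
    rcases eq_or_lt_of_le ht.1 with h0 | h0
    · rw [← h0, hy0]
    · linarith [hneg t ⟨h0, ht.2⟩]
  have htr := trk le_rfl hnp
  have hσ := htr σ ⟨hσ0.le, le_rfl⟩
  have hσe := hend σ ⟨le_rfl, hστ.le⟩
  have hxσ : |x σ - D| ≤ 2 * δ₁ := by
    have := abs_sub_le (x σ) (a σ) D
    linarith
  have hyσ : -(2 * δ₁) ≤ y σ := by
    linarith [(abs_le.1 hσ.2.1).1, (abs_le.1 hσe.2).1]
  have hyσ' := hneg σ ⟨hσ0, le_rfl⟩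
  set x' := fun t => x (t + σ) with hx'
  set y' := fun t => y (t + σ) with hy'
  have h' : IsTraj G x' y' := h.shift σ
  have hx'0 : x' 0 = x σ := by simp [hx']
  have hy'0 : y' 0 = y σ := by simp [hy']
  have late : ∀ b, 0 ≤ b → (∀ t ∈ Set.Icc 0 b, y' t ≤ 0) → ∀ t ∈ Set.Icc 0 b,
      y σ + -D / 2 * t ≤ y' t ∧ x' t ≤ x σ ∧ x σ - 2 * δ₁ * t ≤ x' t := by
    intro b hb hyb
    have hx1 : ∀ t ∈ Set.Icc 0 b, x' t ≤ x σ := by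
      intro t ht
      have := sub_le_mul_of_deriv_le (c := 0) h'.1 ht.1
        (fun s hs => hyb s ⟨hs.1.le, hs.2.le.trans ht.2⟩)
      linarith
    have hy1 : ∀ t ∈ Set.Icc 0 b, y σ + -D / 2 * t ≤ y' t := by
      intro t ht
      have := mul_le_sub_of_le_deriv (c := -D / 2) h'.2 ht.1 (fun s hs => by
        have hs' : s ∈ Set.Icc 0 b := ⟨hs.1.le, hs.2.le.trans ht.2⟩
        have g1 := P.neg_lower _ (hyb s hs')
        have g2 : 2 * γ * y' s ≤ 0 := mul_nonpos_of_nonneg_of_nonpos (by positivity) (hyb s hs')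
        linarith [hx1 s hs', (abs_le.1 hxσ).2])
      linarith
    intro t ht
    refine ⟨hy1 t ht, hx1 t ht, ?_⟩
    have := mul_le_sub_of_le_deriv (c := -(2 * δ₁)) h'.1 ht.1 (fun s hs => by
      have g1 := hy1 s ⟨hs.1.le, hs.2.le.trans ht.2⟩
      have g2 : 0 ≤ -D / 2 * s := mul_nonneg (by linarith) hs.1.le
      linarith)
    linarith
  set C := 2 * δ₁ / (-D / 2) with hC
  have hC0 : 0 < C := div_pos (by linarith) (by linarith)
  have hC1 : C ≤ 1 := by rw [hC, div_le_one (by linarith)]; linarith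
  have hCD : -D / 2 * C = 2 * δ₁ := by rw [hC, mul_div_cancel₀ _ (by linarith)]
  have hcont' : Continuous fun t => -y' t := h'.continuous_snd.neg
  have hev' : ∀ᶠ t in nhdsWithin 0 (Set.Ioi (0 : ℝ)), 0 < -y' t := by
    refine ((hcont'.tendsto 0).eventually (lt_mem_nhds ?_)).filter_mono nhdsWithin_le_nhds
    simp only [hy'0]; exact hyσ'
  rcases pos_or_exists_first_zero hcont' hev' C with H | ⟨T, hT, hT0, hTlt⟩
  · exfalso
    have := late C hC0.le (fun t ht => by
      rcases eq_or_lt_of_le ht.1 with h0 | h0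
      · rw [← h0, hy'0]; linarith
      · linarith [H t ⟨h0, ht.2⟩]) C ⟨hC0.le, le_rfl⟩
    linarith [H C ⟨hC0, le_rfl⟩]
  · have hyT : y' T = 0 := by linarith
    have hyT' : ∀ t ∈ Set.Icc 0 T, y' t ≤ 0 := by
      intro t ht
      rcases eq_or_lt_of_le ht.1 with h0 | h0
      · rw [← h0, hy'0]; linarith
      · rcases eq_or_lt_of_le ht.2 with h1 | h1
        · rw [h1, hyT]
        · linarith [hTlt t ⟨h0, h1⟩]
    have hl := late T hT.1.le hyT'
    have hbd : ∀ t ∈ Set.Icc 0 T, |x' t - D| ≤ 4 * δ₁ ∧ |y' t| ≤ 2 * δ₁ := by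
      intro t ht
      obtain ⟨l1, l2, l3⟩ := hl t ht
      have l4 : 2 * δ₁ * t ≤ 2 * δ₁ * 1 :=
        mul_le_mul_of_nonneg_left (by linarith [ht.2, hT.2]) (by linarith)
      have l5 : 0 ≤ -D / 2 * t := mul_nonneg (by linarith) ht.1
      have l6 := abs_le.1 hxσ
      constructor
      · rw [abs_le]; constructor <;> linarith
      · rw [abs_le]; constructor
        · linarith
        · linarith [hyT' t ht]
    have hend' := hbd T ⟨hT.1.le, le_rfl⟩
    refine ⟨T + σ, by linarith [hT.1], by linarith [hT.2], hyT, ?_, ?_, ?_⟩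
    · exact hend'.1.trans (by linarith)
    · intro t ht
      rcases le_or_gt t σ with hts | hts
      · have hq := htr t ⟨ht.1, hts⟩
        exact ⟨hnp t ⟨ht.1, hts⟩, t, ⟨ht.1, hts.trans hστ.le⟩, by linarith [hq.1],
          by linarith [hq.2.1]⟩
      · have hm : t - σ ∈ Set.Icc 0 T := ⟨by linarith, by linarith [ht.2]⟩
        have hq := hbd _ hm
        have hq2 := hyT' _ hm
        simp only [hx', hy', sub_add_cancel] at hq hq2
        refine ⟨hq2, τ, ⟨A.τ_pos.le, le_rfl⟩, ?_, ?_⟩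
        · rw [A.fst_τ]; linarith [hq.1]
        · rw [A.snd_τ, sub_zero]; linarith [hq.2]
    · intro s hs
      rcases le_or_gt s σ with hss | hss
      · have hq := htr s ⟨hs.1, hss⟩
        exact ⟨s, ⟨hs.1, by linarith [hT.1]⟩, by linarith [hq.1], by linarith [hq.2.1]⟩
      · have hq := hend s ⟨hss.le, hs.2⟩
        refine ⟨T + σ, ⟨by linarith [hT.1], le_rfl⟩, ?_, ?_⟩
        · have h1 : |x (T + σ) - D| ≤ 4 * δ₁ := hend'.1
          have h2 := abs_sub_le (x (T + σ)) D (a s)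
          rw [abs_sub_comm D] at h2
          linarith [hq.1]
        · have h1 : y (T + σ) = 0 := hyT
          rw [h1, zero_sub, abs_neg]
          linarith [hq.2]

lemma eventually_mul_le (c : ℝ) {d : ℝ} (hd : 0 < d) :
    ∀ᶠ ε in nhdsWithin 0 (Set.Ioi (0 : ℝ)), ε * c ≤ d := by
  have h : Filter.Tendsto (fun ε : ℝ => ε * c) (nhdsWithin 0 (Set.Ioi (0 : ℝ))) (nhds (0 * c)) :=
    (Filter.tendsto_id.mono_left nhdsWithin_le_nhds).mul_const c
  rw [zero_mul] at h
  exact (h.eventually (gt_mem_nhds hd)).mono fun _ h => h.le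

/-- An upper bound for the time it takes to go once around the fast part of the cycle. -/
noncomputable def circuitTime (γ e X s₁ S L τ : ℝ) : ℝ :=
  2 * (S + L * (2 + S ^ 2 + 2 * γ * s₁)) / (X - e) + 1 + (τ + 1) + 1

/-- The point `(x, y)` is `δ`-close to the singular cycle. -/
def NearCycle (τ X D δ : ℝ) (a b : ℝ → ℝ) (x y : ℝ) : Prop :=
  (∃ s ∈ Set.Icc 0 τ, |x - a s| ≤ δ ∧ |y - b s| ≤ δ) ∨
    ∃ ξ ∈ Set.Icc D X, |x - ξ| ≤ δ ∧ |y| ≤ δ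

lemma nearCycle_of_upper {τ X D δ x y : ℝ} (a b : ℝ → ℝ) (hDX : D ≤ X) (hx : D - δ ≤ x)
    (hx' : x ≤ X + δ) (hy : 0 ≤ y) (hy' : y ≤ δ) : NearCycle τ X D δ a b x y := by
  refine Or.inr ⟨max D (min x X), ⟨le_max_left _ _, max_le hDX (min_le_right _ _)⟩, ?_, ?_⟩
  · rw [abs_le]
    constructor
    · have : max D (min x X) ≤ x + δ := max_le (by linarith) ((min_le_left _ _).trans (by linarith))
      linarith
    · have : x - δ ≤ max D (min x X) :=
        le_max_of_le_right (le_min (by linarith) (by linarith))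
      linarith
  · rwa [abs_of_nonneg hy]

lemma eventually_circuit {γ μ e X τ D : ℝ} {a b : ℝ → ℝ} (r s₁ s₀ S L m : ℝ)
    (A : IsLinArc γ X τ D a b) (hγ : 0 < γ) (heX : e < X) (hX : 0 < X) {δ : ℝ} (hδ : 0 < δ) :
    ∀ᶠ ε in nhdsWithin 0 (Set.Ioi (0 : ℝ)), ∀ G,
      IsProfile γ μ e X r s₁ s₀ S L m ε G → ∀ x y, IsTraj G x y →
      x 0 = X - 2 * γ * (ε * s₁) → ε * s₁ ≤ y 0 → y 0 ≤ ε * S →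
      (∀ t ∈ Set.Icc 0 (circuitTime γ e X s₁ S L τ), y t ≤ ε * S) ∧
      -r ≤ x (circuitTime γ e X s₁ S L τ) ∧ x (circuitTime γ e X s₁ S L τ) ≤ D / 2 ∧
      ε * s₀ ≤ y (circuitTime γ e X s₁ S L τ) ∧
      ∃ T > circuitTime γ e X s₁ S L τ, x T = X - 2 * γ * (ε * s₁) ∧
        (∀ t ∈ Set.Icc (circuitTime γ e X s₁ S L τ) T, ε * s₁ ≤ y t ∧ y t ≤ ε * S) ∧
        (∀ t ∈ Set.Icc 0 T, NearCycle τ X D δ a b (x t) (y t)) ∧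
        (∀ s ∈ Set.Icc 0 τ, ∃ t ∈ Set.Icc 0 T, |x t - a s| ≤ δ ∧ |y t - b s| ≤ δ) ∧
        (∀ ξ ∈ Set.Icc D X, ∃ t ∈ Set.Icc 0 T, |x t - ξ| ≤ δ ∧ |y t| ≤ δ) := by
  have hD := A.D_neg
  have hτ := A.τ_pos
  obtain ⟨δ', hδ', hδδ, hδ1, hδD⟩ : ∃ δ' > 0, δ' ≤ δ ∧ δ' ≤ 1 ∧ 4 * δ' ≤ -D :=
    ⟨min δ (min 1 (-D / 4)), lt_min hδ (lt_min one_pos (by linarith)), min_le_left _ _,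
      (min_le_right _ _).trans (min_le_left _ _),
      by linarith [(min_le_right δ (min 1 (-D / 4))).trans (min_le_right _ _)]⟩
  have hDX : -X ≤ D := by
    have := A.abs_fst_le τ hτ.le
    rw [A.fst_τ] at this
    exact (abs_le.1 this).1
  set Ts := circuitTime γ e X s₁ S L τ with hTs
  filter_upwards [eventually_lower_arc (μ := μ) r s₁ s₀ S L m A hγ heX (2 + S ^ 2 + 2 * γ * s₁) hδ',
    eventually_mul_le (2 * γ * s₁) (d := (X - e) / 2) (by linarith),
    eventually_mul_le (2 * γ * s₁) hX,
    eventually_mul_le (2 * γ * s₁) hδ, eventually_mul_le (2 + S ^ 2) hδ, eventually_mul_le S hδ,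
    eventually_mul_le (S * Ts) (d := -D / 4) (by linarith),
    eventually_mul_le (2 * γ * s₀) (d := -D / 8) (by linarith),
    eventually_mul_le s₀ (d := -D / 4) (by linarith)]
    with ε hlow hsm1 hsm2 hsm3 hsm4 hsm5 hsm6 hsm7 hsm8 G P x y h hx0 hy0 hy1
  have hε := P.ε_pos
  have hS := P.S_pos
  have hs₁ := P.s₁_pos
  have hp := P.εs₁_pos
  have hq := P.εs₁_lt
  have hq' := P.εs₀_lt
  obtain ⟨T₁, hT₁, hT₁', hyT₁, hb₁⟩ := P.exit h hx0 hy0 hy1 (by linarith)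
  have h₁ := h.shift T₁
  obtain ⟨T₂, hT₂, hT₂', hyT₂, hxT₂, hb₂, hb₂'⟩ := hlow G P _ _ h₁ (by simpa using hyT₁) (by
    have := hb₁ T₁ ⟨hT₁.le, le_rfl⟩
    have h2 : 0 < ε * (2 + S ^ 2) := by positivity
    have h3 : 0 < γ * (ε * s₁) := by positivity
    simp only [zero_add]
    rw [abs_le]; constructor <;> linarith)
  have h₂ := h₁.shift T₂
  have hTs' : T₁ + T₂ + 1 ≤ Ts := by rw [hTs, circuitTime]; linarith
  have hxT₂' := abs_le.1 hxT₂
  have hxT : x (T₂ + T₁) ≤ 3 * D / 4 := by linarith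
  have hxT' : -r ≤ x (T₂ + T₁) := by linarith [P.X_lt]
  set C := Ts - (T₁ + T₂) with hC
  have hCle : ε * S * C ≤ -D / 4 := by
    have : ε * S * C ≤ ε * S * Ts :=
      mul_le_mul_of_nonneg_left (by linarith) (by positivity)
    linarith
  obtain ⟨hb₃, hb₃'⟩ := P.climb h₂ (D := D) (C := C) (by linarith) (by simpa using hxT')
    (by simpa using hxT) (by simpa using hyT₂) hCle (by linarith) (by linarith)
  have hC1 : C ∈ Set.Icc 0 C := ⟨by linarith, le_rfl⟩
  have hCT : C + T₂ + T₁ = Ts := by rw [hC]; ring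
  have hc3 := hb₃ C hC1
  have hc3' := hb₃' C ⟨by linarith, le_rfl⟩
  simp only [hCT, zero_add] at hc3 hc3'
  obtain ⟨T₄, hT₄, hxT₄, hb₄⟩ := P.reach_fold (h.shift Ts) (by simp only [zero_add]; linarith)
    (by simp only [zero_add]; linarith) (by simp only [zero_add]; linarith)
    (by simp only [zero_add]; linarith)
  simp only [zero_add] at hb₄
  have u₂ : ∀ t ∈ Set.Icc T₁ (T₁ + T₂), y t ≤ 0 ∧
      ∃ s ∈ Set.Icc 0 τ, |x t - a s| ≤ δ' ∧ |y t - b s| ≤ δ' := by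
    intro t ht
    have := hb₂ (t - T₁) ⟨by linarith [ht.1], by linarith [ht.2]⟩
    simpa only [sub_add_cancel] using this
  have u₃ : ∀ t ∈ Set.Icc (T₁ + T₂) Ts, 0 ≤ y t ∧ y t ≤ ε * S ∧ x (T₂ + T₁) ≤ x t ∧
      x t ≤ D / 2 := by
    intro t ht
    have := hb₃ (t - (T₁ + T₂)) ⟨by linarith [ht.1], by linarith [ht.2]⟩
    have e1 : t - (T₁ + T₂) + T₂ + T₁ = t := by ring
    simpa only [e1, zero_add] using this
  have u₄ : ∀ t ∈ Set.Icc Ts (T₄ + Ts), ε * s₁ ≤ y t ∧ y t ≤ ε * S ∧ x Ts ≤ x t ∧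
      x t ≤ X - 2 * γ * (ε * s₁) := by
    intro t ht
    have := hb₄ (t - Ts) ⟨by linarith [ht.1], by linarith [ht.2]⟩
    simpa only [sub_add_cancel] using this
  have hγs : 0 < γ * (ε * s₁) := by positivity
  refine ⟨?_, by linarith, by linarith, by linarith, T₄ + Ts, by linarith, hxT₄,
    fun t ht => ⟨(u₄ t ht).1, (u₄ t ht).2.1⟩, ?_, ?_, ?_⟩
  · intro t ht
    rcases le_or_gt t T₁ with c1 | c1
    · exact (hb₁ t ⟨ht.1, c1⟩).2.1
    · rcases le_or_gt t (T₁ + T₂) with c2 | c2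
      · exact (u₂ t ⟨c1.le, c2⟩).1.trans (by positivity)
      · exact (u₃ t ⟨c2.le, ht.2⟩).2.1
  · intro t ht
    rcases le_or_gt t T₁ with c1 | c1
    · obtain ⟨v1, v2, v3, v4⟩ := hb₁ t ⟨ht.1, c1⟩
      exact nearCycle_of_upper a b (by linarith) (by linarith) (by linarith) v1 (by linarith)
    · rcases le_or_gt t (T₁ + T₂) with c2 | c2
      · obtain ⟨-, s, hs, v1, v2⟩ := u₂ t ⟨c1.le, c2⟩
        exact Or.inl ⟨s, hs, v1.trans hδδ, v2.trans hδδ⟩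
      · rcases le_or_gt t Ts with c3 | c3
        · obtain ⟨v1, v2, v3, v4⟩ := u₃ t ⟨c2.le, c3⟩
          exact nearCycle_of_upper a b (by linarith) (by linarith) (by linarith) v1 (by linarith)
        · obtain ⟨v1, v2, v3, v4⟩ := u₄ t ⟨c3.le, ht.2⟩
          exact nearCycle_of_upper a b (by linarith) (by linarith) (by linarith) (by linarith)
            (by linarith)
  · intro s hs
    obtain ⟨t, ht, v1, v2⟩ := hb₂' s hs
    exact ⟨t + T₁, ⟨by linarith [ht.1], by linarith [ht.2]⟩, v1.trans hδδ, v2.trans hδδ⟩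
  · intro ξ hξ
    have hle : T₁ + T₂ ≤ T₄ + Ts := by linarith
    have hxx : x (T₁ + T₂) = x (T₂ + T₁) := by rw [add_comm]
    have hmem : max (x (T₁ + T₂)) (min ξ (X - 2 * γ * (ε * s₁))) ∈
        Set.Icc (x (T₁ + T₂)) (x (T₄ + Ts)) := by
      refine ⟨le_max_left _ _, max_le ?_ ?_⟩
      · rw [hxx, hxT₄]; linarith
      · rw [hxT₄]; exact min_le_right _ _
    obtain ⟨t, ht, hxt⟩ := intermediate_value_Icc hle h.continuous_fst.continuousOn hmem
    refine ⟨t, ⟨by linarith [ht.1], ht.2⟩, ?_, ?_⟩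
    · rw [hxt, hxx, abs_le]
      constructor
      · have : ξ - δ ≤ max (x (T₂ + T₁)) (min ξ (X - 2 * γ * (ε * s₁))) :=
          le_max_of_le_right (le_min (by linarith) (by linarith [hξ.2]))
        linarith
      · have : max (x (T₂ + T₁)) (min ξ (X - 2 * γ * (ε * s₁))) ≤ ξ + δ :=
          max_le (by linarith [hξ.1]) ((min_le_left _ _).trans (by linarith))
        linarith
    · rcases le_or_gt t Ts with c3 | c3
      · obtain ⟨v1, v2, v3, v4⟩ := u₃ t ⟨ht.1, c3⟩
        rw [abs_of_nonneg v1]; linarith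
      · obtain ⟨v1, v2, v3, v4⟩ := u₄ t ⟨c3.le, ht.2⟩
        rw [abs_of_nonneg (by linarith)]; linarith

/-- A trajectory with `y ≥ ℓ > 0` is a graph over the `x`-axis; `θ` is the inverse of `x`. -/
lemma IsTraj.exists_inverse {G x y : ℝ → ℝ} (h : IsTraj G x y) {ℓ T : ℝ} (hℓ : 0 < ℓ)
    (hT : 0 ≤ T) (hy : ∀ t ∈ Set.Icc 0 T, ℓ ≤ y t) :
    ∃ θ : ℝ → ℝ, θ (x 0) = 0 ∧ θ (x T) = T ∧ (∀ ξ, HasDerivAt θ (max (y (θ ξ)) ℓ)⁻¹ ξ) ∧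
      ∀ ξ ∈ Set.Icc (x 0) (x T), θ ξ ∈ Set.Icc 0 T ∧ x (θ ξ) = ξ := by
  have hc : Continuous fun t => max (y t) ℓ := h.continuous_snd.max continuous_const
  let z : ℝ → ℝ := fun t => x 0 + ∫ s in (0 : ℝ)..t, max (y s) ℓ
  have hz : ∀ t, HasDerivAt z (max (y t) ℓ) t := fun t =>
    (hc.integral_hasStrictDerivAt 0 t).hasDerivAt.const_add _
  have hz0 : z 0 = x 0 := by simp [z]
  have hzx : ∀ t ∈ Set.Icc 0 T, z t = x t := by
    intro t ht
    have hd : ∀ s ∈ Set.Ioo 0 t, max (y s) ℓ - y s = 0 := by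
      intro s hs
      rw [max_eq_left (hy s ⟨hs.1.le, hs.2.le.trans ht.2⟩), sub_self]
    have h1 := sub_le_mul_of_deriv_le (fun s => (hz s).sub (h.1 s)) ht.1 (fun s hs => (hd s hs).le)
    have h2 := mul_le_sub_of_le_deriv (fun s => (hz s).sub (h.1 s)) ht.1 (fun s hs => (hd s hs).ge)
    simp only [Pi.sub_apply, hz0, sub_self, zero_mul] at h1 h2
    linarith
  have hmono : StrictMono z := strictMono_of_hasDerivAt_pos hz
    (fun t => hℓ.trans_le (le_max_right _ _))
  have hcz : Continuous z := continuous_iff_continuousAt.2 fun t => (hz t).continuousAt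
  have hgrow : ∀ s t, s ≤ t → ℓ * (t - s) ≤ z t - z s := fun s t hst =>
    mul_le_sub_of_le_deriv hz hst (fun _ _ => le_max_right _ _)
  have hsurj : Function.Surjective z := by
    refine hcz.surjective ?_ ?_
    · refine Filter.tendsto_atTop_mono' _ ?_
        (Filter.tendsto_atTop_add_const_left _ (x 0) (Filter.tendsto_id.const_mul_atTop hℓ))
      filter_upwards [Filter.eventually_ge_atTop 0] with t ht
      have := hgrow 0 t ht
      simp only [id]
      linarith
    · refine Filter.tendsto_atBot_mono' _ ?_
        (Filter.tendsto_atBot_add_const_left _ (x 0) (Filter.tendsto_id.const_mul_atBot hℓ))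
      filter_upwards [Filter.eventually_le_atBot 0] with t ht
      have := hgrow t 0 ht
      simp only [id]
      linarith
  let φ := hmono.orderIsoOfSurjective z hsurj
  have hφ : ∀ t, φ t = z t := fun t => rfl
  have hleft : ∀ t, φ.symm (z t) = t := fun t => φ.symm_apply_apply t
  have hright : ∀ ξ, z (φ.symm ξ) = ξ := fun ξ => φ.apply_symm_apply ξ
  refine ⟨φ.symm, ?_, ?_, ?_, ?_⟩
  · rw [← hz0]; exact hleft 0
  · rw [← hzx T ⟨hT, le_rfl⟩]; exact hleft T
  · intro ξ
    exact HasDerivAt.of_local_left_inverse φ.symm.continuous.continuousAt (hz _)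
      (hℓ.trans_le (le_max_right _ _)).ne' (Filter.Eventually.of_forall hright)
  · intro ξ hξ
    have hm : φ.symm ξ ∈ Set.Icc 0 T := by
      rw [← hz0, ← hzx T ⟨hT, le_rfl⟩] at hξ
      constructor
      · exact hmono.le_iff_le.1 (by rw [hright]; exact hξ.1)
      · exact hmono.le_iff_le.1 (by rw [hright]; exact hξ.2)
    exact ⟨hm, by rw [← hzx _ hm, hright]⟩

/-- The vector field of the system `ẋ = y`, `ẏ = -x + G y` is Lipschitz where `G` is. -/
lemma lipschitzOnWith_field {G : ℝ → ℝ} {s : Set ℝ} {K : ℝ} (hK : 0 ≤ K)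
    (hG : ∀ y ∈ s, ∀ z ∈ s, |G y - G z| ≤ K * |y - z|) :
    LipschitzOnWith (Real.toNNReal (1 + K)) (fun p : ℝ × ℝ => (p.2, -p.1 + G p.2))
      {p | p.2 ∈ s} := by
  refine LipschitzOnWith.of_dist_le_mul fun p hp q hq => ?_
  rw [Real.coe_toNNReal _ (by linarith)]
  have hd := Prod.dist_eq (x := p) (y := q)
  rw [Prod.dist_eq]
  have h1 : |p.1 - q.1| ≤ dist p q := by
    rw [hd, ← Real.dist_eq]; exact le_max_left _ _
  have h2 : |p.2 - q.2| ≤ dist p q := by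
    rw [hd, ← Real.dist_eq]; exact le_max_right _ _
  have h3 : K * |p.2 - q.2| ≤ K * dist p q := mul_le_mul_of_nonneg_left h2 hK
  have h4 := hG _ hp _ hq
  have h5 : 0 ≤ K * dist p q := mul_nonneg hK dist_nonneg
  refine max_le ?_ ?_
  · rw [Real.dist_eq]; linarith
  · rw [Real.dist_eq]
    have : -p.1 + G p.2 - (-q.1 + G q.2) = -(p.1 - q.1) + (G p.2 - G q.2) := by ring
    rw [this]
    refine (abs_add_le _ _).trans ?_
    rw [abs_neg]
    linarith

namespace IsProfile

variable {γ μ e X r s₁ s₀ S L m ε : ℝ} {G x₁ y₁ x₂ y₂ : ℝ → ℝ}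

lemma gronwall (P : IsProfile γ μ e X r s₁ s₀ S L m ε G) (h₁ : IsTraj G x₁ y₁)
    (h₂ : IsTraj G x₂ y₂) {T : ℝ} (hy₁ : ∀ t ∈ Set.Icc 0 T, y₁ t ≤ ε * S)
    (hy₂ : ∀ t ∈ Set.Icc 0 T, y₂ t ≤ ε * S) (hT : 0 ≤ T) (hx : x₁ 0 = x₂ 0) :
    |x₁ T - x₂ T| ≤ |y₁ 0 - y₂ 0| * Real.exp ((1 + L / ε) * T) ∧
      |y₁ T - y₂ T| ≤ |y₁ 0 - y₂ 0| * Real.exp ((1 + L / ε) * T) := by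
  have hK : 0 < L / ε := div_pos P.L_pos P.ε_pos
  have key := dist_le_of_trajectories_ODE_of_mem (K := Real.toNNReal (1 + L / ε))
    (v := fun _ p => (p.2, -p.1 + G p.2)) (s := fun _ => {p : ℝ × ℝ | p.2 ≤ ε * S})
    (f := fun t => (x₁ t, y₁ t)) (g := fun t => (x₂ t, y₂ t)) (a := 0) (b := T)
    (δ := |y₁ 0 - y₂ 0|) ?_ ?_ ?_ ?_ ?_ ?_ ?_ ?_ T ⟨hT, le_rfl⟩
  · rw [Prod.dist_eq, sub_zero, Real.dist_eq, Real.dist_eq,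
      Real.coe_toNNReal _ (by linarith)] at key
    exact max_le_iff.1 key
  · exact fun t _ => lipschitzOnWith_field (s := Set.Iic (ε * S)) hK.le P.lip
  · exact (h₁.continuous_fst.prodMk h₁.continuous_snd).continuousOn
  · exact fun t _ => ((h₁.1 t).prodMk (h₁.2 t)).hasDerivWithinAt
  · exact fun t ht => hy₁ t ⟨ht.1, ht.2.le⟩
  · exact (h₂.continuous_fst.prodMk h₂.continuous_snd).continuousOn
  · exact fun t _ => ((h₂.1 t).prodMk (h₂.2 t)).hasDerivWithinAt
  · exact fun t ht => hy₂ t ⟨ht.1, ht.2.le⟩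
  · rw [Prod.dist_eq, hx, dist_self, Real.dist_eq]
    simp

lemma abs_G_le (P : IsProfile γ μ e X r s₁ s₀ S L m ε G) {y : ℝ} (hy : 0 ≤ y)
    (hy' : y ≤ ε * S) : |G y| ≤ e + L * S := by
  have hε := P.ε_pos
  have hL := P.L_pos
  have h := P.lip y hy' 0 (mul_pos hε P.S_pos).le
  rw [P.zero, sub_zero, abs_of_nonneg hy] at h
  have h2 : L / ε * y ≤ L / ε * (ε * S) := mul_le_mul_of_nonneg_left hy' (by positivity)
  have h3 : L / ε * (ε * S) = L * S := by field_simp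
  have := abs_sub_abs_le_abs_sub (G y) e
  rw [abs_of_pos P.e_pos] at this
  linarith

set_option maxHeartbeats 1000000 in
/-- Two trajectories are attracted to each other along the slow branch. -/
lemma slow_contraction_aux (P : IsProfile γ μ e X r s₁ s₀ S L m ε G) (h₁ : IsTraj G x₁ y₁)
    (h₂ : IsTraj G x₂ y₂) {D T₁ T₂ Δ : ℝ} (hT₁ : 0 ≤ T₁) (hT₂ : 0 ≤ T₂)
    (hx₂ : -r ≤ x₂ 0) (hx : x₂ 0 ≤ x₁ 0) (hx₁ : x₁ 0 ≤ D / 2)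
    (hy₁ : ε * s₀ ≤ y₁ 0) (hy₂ : ε * s₀ ≤ y₂ 0)
    (hxT₁ : x₁ T₁ = X - 2 * γ * (ε * s₁)) (hxT₂ : x₂ T₂ = X - 2 * γ * (ε * s₁))
    (hb₁ : ∀ t ∈ Set.Icc 0 T₁, ε * s₁ ≤ y₁ t ∧ y₁ t ≤ ε * S)
    (hb₂ : ∀ t ∈ Set.Icc 0 T₂, ε * s₁ ≤ y₂ t ∧ y₂ t ≤ ε * S)
    (hD : D < 0) (hsm : 2 * γ * (ε * s₀) < -D / 4) (hsm' : 2 * γ * (ε * s₁) ≤ X)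
    (hΔx : |x₁ 0 - x₂ 0| ≤ Δ) (hΔy : |y₁ 0 - y₂ 0| ≤ Δ) :
    |y₁ T₁ - y₂ T₂| ≤ (S + (r + e + L * S)) / (s₁ * ε) *
      Real.exp (m * D / (4 * S) * (1 / ε) ^ 2) * Δ := by
  have hε := P.ε_pos
  have hS := P.S_pos
  have hs₁ := P.s₁_pos
  have hm := P.m_pos
  have hp := P.εs₁_pos
  have hL := P.L_pos
  have he := P.e_pos
  have hr := P.r_pos
  have hεS : 0 < ε * S := mul_pos hε hS
  have hΔ0 : 0 ≤ Δ := (abs_nonneg _).trans hΔy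
  set Xf := X - 2 * γ * (ε * s₁) with hXf
  have hXf0 : 0 ≤ Xf := by linarith
  have hXfr : Xf ≤ r := by
    have : 0 < 2 * γ * (ε * s₁) := mul_pos (mul_pos two_pos P.γ_pos) hp
    linarith [P.X_lt]
  obtain ⟨θ₁, hθ₁0, hθ₁T, hθ₁d, hθ₁⟩ := h₁.exists_inverse hp hT₁ (fun t ht => (hb₁ t ht).1)
  obtain ⟨θ₂, hθ₂0, hθ₂T, hθ₂d, hθ₂⟩ := h₂.exists_inverse hp hT₂ (fun t ht => (hb₂ t ht).1)
  rw [hxT₁] at hθ₁ hθ₁T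
  rw [hxT₂] at hθ₂ hθ₂T
  have hE : ∀ {x y θ : ℝ → ℝ}, IsTraj G x y → (∀ ξ, HasDerivAt θ (max (y (θ ξ)) (ε * s₁))⁻¹ ξ) →
      ∀ ξ, HasDerivAt (fun ξ => y (θ ξ) ^ 2 / 2)
        (y (θ ξ) * (-x (θ ξ) + G (y (θ ξ))) * (max (y (θ ξ)) (ε * s₁))⁻¹) ξ := by
    intro x y θ h hθ ξ
    refine ((((h.2 (θ ξ)).comp ξ (hθ ξ)).pow 2).div_const 2).congr_deriv ?_
    simp
    ring
  have hE₁ := hE h₁ hθ₁d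
  have hE₂ := hE h₂ hθ₂d
  have hF₁ : ∀ ξ ∈ Set.Icc (x₁ 0) Xf, ε * s₁ ≤ y₁ (θ₁ ξ) ∧ y₁ (θ₁ ξ) ≤ ε * S ∧
      y₁ (θ₁ ξ) * (-x₁ (θ₁ ξ) + G (y₁ (θ₁ ξ))) * (max (y₁ (θ₁ ξ)) (ε * s₁))⁻¹ =
        -ξ + G (y₁ (θ₁ ξ)) := by
    intro ξ hξ
    have hb := hb₁ _ (hθ₁ ξ hξ).1
    refine ⟨hb.1, hb.2, ?_⟩
    rw [(hθ₁ ξ hξ).2, max_eq_left hb.1]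
    have : y₁ (θ₁ ξ) ≠ 0 := (hp.trans_le hb.1).ne'
    field_simp
  have hF₂ : ∀ ξ ∈ Set.Icc (x₂ 0) Xf, ε * s₁ ≤ y₂ (θ₂ ξ) ∧ y₂ (θ₂ ξ) ≤ ε * S ∧
      y₂ (θ₂ ξ) * (-x₂ (θ₂ ξ) + G (y₂ (θ₂ ξ))) * (max (y₂ (θ₂ ξ)) (ε * s₁))⁻¹ =
        -ξ + G (y₂ (θ₂ ξ)) := by
    intro ξ hξ
    have hb := hb₂ _ (hθ₂ ξ hξ).1
    refine ⟨hb.1, hb.2, ?_⟩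
    rw [(hθ₂ ξ hξ).2, max_eq_left hb.1]
    have : y₂ (θ₂ ξ) ≠ 0 := (hp.trans_le hb.1).ne'
    field_simp
  have hhigh : ∀ {x y θ : ℝ → ℝ} {T : ℝ}, IsTraj G x y → ε * s₀ ≤ y 0 →
      (∀ t ∈ Set.Icc 0 T, ε * s₁ ≤ y t ∧ y t ≤ ε * S) →
      (∀ ξ ∈ Set.Icc (x 0) Xf, θ ξ ∈ Set.Icc 0 T ∧ x (θ ξ) = ξ) →
      ∀ ξ ∈ Set.Icc (x 0) Xf, ξ ≤ D / 4 → ε * s₀ ≤ y (θ ξ) := by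
    intro x y θ T h hy hb hθ ξ hξ hξD
    have h1 := hθ ξ hξ
    refine h.stay_above (a := 0) (b := θ ξ) hy (fun t ht => ?_) _ ⟨h1.1.1, le_rfl⟩
    have : x t ≤ x (θ ξ) := h.fst_mono ht.2.le
      (fun s hs => hp.le.trans (hb s ⟨ht.1.trans hs.1, hs.2.trans h1.1.2⟩).1)
    rw [h1.2] at this
    rw [P.at_s₀]
    linarith
  set d := fun ξ => y₁ (θ₁ ξ) ^ 2 / 2 - y₂ (θ₂ ξ) ^ 2 / 2 with hd
  set k := 2 * m / (S * ε ^ 2) with hk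
  have hk0 : 0 < k := by positivity
  have hdd : ∀ ξ, HasDerivAt d _ ξ := fun ξ => (hE₁ ξ).sub (hE₂ ξ)
  have hI : ∀ ξ ∈ Set.Icc (x₁ 0) Xf, ξ ∈ Set.Icc (x₂ 0) Xf := fun ξ hξ => ⟨hx.trans hξ.1, hξ.2⟩
  -- the difference decreases
  have hdec : ∀ ξ ∈ Set.Icc (x₁ 0) Xf, d ξ * (G (y₁ (θ₁ ξ)) - G (y₂ (θ₂ ξ))) ≤ 0 := by
    intro ξ hξ
    obtain ⟨b1, b2, -⟩ := hF₁ ξ hξ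
    obtain ⟨c1, c2, -⟩ := hF₂ ξ (hI ξ hξ)
    have : d ξ = (y₁ (θ₁ ξ) - y₂ (θ₂ ξ)) * ((y₁ (θ₁ ξ) + y₂ (θ₂ ξ)) / 2) := by rw [hd]; ring
    rw [this]
    have hpos : 0 ≤ (y₁ (θ₁ ξ) + y₂ (θ₂ ξ)) / 2 := by linarith
    rcases le_total (y₁ (θ₁ ξ)) (y₂ (θ₂ ξ)) with hle | hle
    · have := P.anti _ _ b1 hle c2
      exact mul_nonpos_of_nonpos_of_nonneg
        (mul_nonpos_of_nonpos_of_nonneg (by linarith) hpos) (by linarith)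
    · have := P.anti _ _ c1 hle b2
      exact mul_nonpos_of_nonneg_of_nonpos (mul_nonneg (by linarith) hpos) (by linarith)
  have hdec' : ∀ ξ ∈ Set.Icc (x₁ 0) (D / 4),
      2 * d ξ * (G (y₁ (θ₁ ξ)) - G (y₂ (θ₂ ξ))) ≤ -k * d ξ ^ 2 := by
    intro ξ hξ
    have hξ' : ξ ∈ Set.Icc (x₁ 0) Xf := ⟨hξ.1, by linarith [hξ.2]⟩
    obtain ⟨-, b2, -⟩ := hF₁ ξ hξ'
    obtain ⟨-, c2, -⟩ := hF₂ ξ (hI ξ hξ')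
    have b1 := hhigh h₁ hy₁ hb₁ hθ₁ ξ hξ' hξ.2
    have c1 := hhigh h₂ hy₂ hb₂ hθ₂ ξ (hI ξ hξ') hξ.2
    have hdξ : d ξ = (y₁ (θ₁ ξ) - y₂ (θ₂ ξ)) * ((y₁ (θ₁ ξ) + y₂ (θ₂ ξ)) / 2) := by rw [hd]; ring
    set u := y₁ (θ₁ ξ)
    set v := y₂ (θ₂ ξ)
    have hu0 : 0 < u + v := by linarith [P.εs₁_lt]
    have hq : (u - v) * (G u - G v) ≤ -(m / ε) * (u - v) ^ 2 := by
      rcases le_total u v with hle | hle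
      · have := mul_le_mul_of_nonneg_left (P.anti_strong u v b1 hle c2) (sub_nonneg.2 hle)
        nlinarith
      · have := mul_le_mul_of_nonneg_left (P.anti_strong v u c1 hle b2) (sub_nonneg.2 hle)
        nlinarith
    have h1 : 2 * d ξ * (G u - G v) ≤ -(m / ε) * (u - v) ^ 2 * (u + v) := by
      have : 2 * d ξ * (G u - G v) = (u - v) * (G u - G v) * (u + v) := by rw [hdξ]; ring
      rw [this]
      exact mul_le_mul_of_nonneg_right hq hu0.le
    have h2 : k * d ξ ^ 2 ≤ (m / ε) * (u - v) ^ 2 * (u + v) := by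
      have e1 : k * d ξ ^ 2 = (m / ε) * (u - v) ^ 2 * (u + v) * ((u + v) / (2 * (ε * S))) := by
        rw [hdξ, hk]; field_simp
      rw [e1]
      refine mul_le_of_le_one_right (by positivity) ?_
      rw [div_le_one (by positivity)]
      linarith
    linarith
  have hsq : d Xf ^ 2 ≤ d (D / 4) ^ 2 := by
    have := sub_le_mul_of_deriv_le (c := 0) (fun ξ => (hdd ξ).pow 2) (a := D / 4) (b := Xf)
      (by linarith) (fun ξ hξ => by
        have hξ' : ξ ∈ Set.Icc (x₁ 0) Xf := ⟨by linarith [hξ.1], hξ.2.le⟩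
        rw [(hF₁ ξ hξ').2.2, (hF₂ ξ (hI ξ hξ')).2.2]
        have := hdec ξ hξ'
        simp only [Nat.cast_ofNat, Nat.add_one_sub_one, pow_one]
        linarith)
    simp only [Pi.pow_apply] at this
    linarith
  have hsq' : Real.exp (k * (D / 4)) * d (D / 4) ^ 2 ≤ Real.exp (k * x₁ 0) * d (x₁ 0) ^ 2 := by
    have := sub_le_mul_of_deriv_le (c := 0)
      (fun ξ => (((hasDerivAt_id ξ).const_mul k).exp).mul ((hdd ξ).pow 2))
      (a := x₁ 0) (b := D / 4) (by linarith) (fun ξ hξ => by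
        have hξ' : ξ ∈ Set.Icc (x₁ 0) Xf := ⟨hξ.1.le, by linarith [hξ.2]⟩
        rw [(hF₁ ξ hξ').2.2, (hF₂ ξ (hI ξ hξ')).2.2]
        have := mul_le_mul_of_nonneg_left (hdec' ξ ⟨hξ.1.le, hξ.2.le⟩)
          (Real.exp_pos (k * ξ)).le
        simp only [Nat.cast_ofNat, Nat.add_one_sub_one, pow_one, id, Pi.pow_apply]
        linarith)
    simp only [Pi.mul_apply, Pi.pow_apply, id] at this
    linarith
  -- the initial difference
  have hd0 : |d (x₁ 0)| ≤ (S + (r + e + L * S)) * Δ := by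
    have hM : ∀ ξ ∈ Set.Ioo (x₂ 0) (x₁ 0), |-ξ + G (y₂ (θ₂ ξ))| ≤ r + e + L * S := by
      intro ξ hξ
      obtain ⟨b1, b2, -⟩ := hF₂ ξ ⟨hξ.1.le, by linarith [hξ.2]⟩
      have h1 := P.abs_G_le (hp.le.trans b1) b2
      have h2 : |ξ| ≤ r := abs_le.2 ⟨by linarith [hξ.1], by linarith [hξ.2]⟩
      have h3 := abs_add_le (-ξ) (G (y₂ (θ₂ ξ)))
      rw [abs_neg] at h3
      linarith
    have hmem : ∀ ξ ∈ Set.Ioo (x₂ 0) (x₁ 0), ξ ∈ Set.Icc (x₂ 0) Xf := fun ξ hξ =>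
      ⟨hξ.1.le, by linarith [hξ.2]⟩
    have u1 := sub_le_mul_of_deriv_le (c := r + e + L * S) hE₂ hx (fun ξ hξ => by
      rw [(hF₂ ξ (hmem ξ hξ)).2.2]; exact (abs_le.1 (hM ξ hξ)).2)
    have u2 := mul_le_sub_of_le_deriv (c := -(r + e + L * S)) hE₂ hx (fun ξ hξ => by
      rw [(hF₂ ξ (hmem ξ hξ)).2.2]; exact (abs_le.1 (hM ξ hξ)).1)
    rw [hθ₂0] at u1 u2
    have u3 : (r + e + L * S) * (x₁ 0 - x₂ 0) ≤ (r + e + L * S) * Δ :=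
      mul_le_mul_of_nonneg_left ((le_abs_self _).trans hΔx) (by positivity)
    have u4 : |y₁ 0 ^ 2 / 2 - y₂ 0 ^ 2 / 2| ≤ S * Δ := by
      have : y₁ 0 ^ 2 / 2 - y₂ 0 ^ 2 / 2 = (y₁ 0 - y₂ 0) * ((y₁ 0 + y₂ 0) / 2) := by ring
      have w1 := hb₁ 0 ⟨le_rfl, hT₁⟩
      have w2 := hb₂ 0 ⟨le_rfl, hT₂⟩
      have w3 : ε * S ≤ 1 * S := mul_le_mul_of_nonneg_right P.ε_le hS.le
      rw [this, abs_mul, abs_of_nonneg (show 0 ≤ (y₁ 0 + y₂ 0) / 2 by linarith), mul_comm S]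
      exact mul_le_mul hΔy (by linarith) (by linarith) hΔ0
    have u5 := abs_le.1 u4
    simp only [hd, hθ₁0]
    rw [abs_le]
    constructor <;> linarith
  set R := (S + (r + e + L * S)) * Δ with hR
  have hR0 : 0 ≤ R := by positivity
  have hfin : d Xf ^ 2 ≤ (Real.exp (k * (D / 8)) * R) ^ 2 := by
    have v1 : d (D / 4) ^ 2 ≤ Real.exp (k * (D / 4)) * d (x₁ 0) ^ 2 := by
      have w1 : Real.exp (k * x₁ 0) ≤ Real.exp (k * (D / 4)) * Real.exp (k * (D / 4)) := by
        rw [← Real.exp_add, Real.exp_le_exp]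
        have := mul_le_mul_of_nonneg_left hx₁ hk0.le
        linarith
      have w2 := hsq'.trans (mul_le_mul_of_nonneg_right w1 (sq_nonneg (d (x₁ 0))))
      rw [mul_assoc] at w2
      exact le_of_mul_le_mul_left w2 (Real.exp_pos _)
    have v2 : d (x₁ 0) ^ 2 ≤ R ^ 2 := sq_le_sq' (abs_le.1 hd0).1 (abs_le.1 hd0).2
    have v3 : Real.exp (k * (D / 4)) = Real.exp (k * (D / 8)) ^ 2 := by
      rw [← Real.exp_nat_mul]; congr 1; push_cast; ring
    calc d Xf ^ 2 ≤ Real.exp (k * (D / 4)) * d (x₁ 0) ^ 2 := hsq.trans v1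
      _ ≤ Real.exp (k * (D / 4)) * R ^ 2 := mul_le_mul_of_nonneg_left v2 (Real.exp_pos _).le
      _ = (Real.exp (k * (D / 8)) * R) ^ 2 := by rw [v3]; ring
  have hfin' : |d Xf| ≤ Real.exp (k * (D / 8)) * R :=
    abs_le_of_sq_le_sq hfin (by positivity)
  have hdXf : d Xf = (y₁ T₁ - y₂ T₂) * ((y₁ T₁ + y₂ T₂) / 2) := by
    simp only [hd, hθ₁T, hθ₂T]; ring
  have w1 := hb₁ T₁ ⟨hT₁, le_rfl⟩
  have w2 := hb₂ T₂ ⟨hT₂, le_rfl⟩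
  have hlow : |y₁ T₁ - y₂ T₂| * (s₁ * ε) ≤ |d Xf| := by
    rw [hdXf, abs_mul, abs_of_nonneg (show 0 ≤ (y₁ T₁ + y₂ T₂) / 2 by linarith)]
    exact mul_le_mul_of_nonneg_left (by linarith) (abs_nonneg _)
  have hexp : k * (D / 8) = m * D / (4 * S) * (1 / ε) ^ 2 := by
    rw [hk]; field_simp; ring
  rw [← hexp]
  have hse : 0 < s₁ * ε := by positivity
  calc |y₁ T₁ - y₂ T₂| ≤ Real.exp (k * (D / 8)) * R / (s₁ * ε) :=
        (le_div_iff₀ hse).2 (hlow.trans hfin')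
    _ = _ := by rw [hR]; ring

lemma slow_contraction (P : IsProfile γ μ e X r s₁ s₀ S L m ε G) (h₁ : IsTraj G x₁ y₁)
    (h₂ : IsTraj G x₂ y₂) {D T₁ T₂ Δ : ℝ} (hT₁ : 0 ≤ T₁) (hT₂ : 0 ≤ T₂)
    (hx₁ : -r ≤ x₁ 0) (hx₂ : -r ≤ x₂ 0) (hx₁' : x₁ 0 ≤ D / 2) (hx₂' : x₂ 0 ≤ D / 2)
    (hy₁ : ε * s₀ ≤ y₁ 0) (hy₂ : ε * s₀ ≤ y₂ 0)
    (hxT₁ : x₁ T₁ = X - 2 * γ * (ε * s₁)) (hxT₂ : x₂ T₂ = X - 2 * γ * (ε * s₁))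
    (hb₁ : ∀ t ∈ Set.Icc 0 T₁, ε * s₁ ≤ y₁ t ∧ y₁ t ≤ ε * S)
    (hb₂ : ∀ t ∈ Set.Icc 0 T₂, ε * s₁ ≤ y₂ t ∧ y₂ t ≤ ε * S)
    (hD : D < 0) (hsm : 2 * γ * (ε * s₀) < -D / 4) (hsm' : 2 * γ * (ε * s₁) ≤ X)
    (hΔx : |x₁ 0 - x₂ 0| ≤ Δ) (hΔy : |y₁ 0 - y₂ 0| ≤ Δ) :
    |y₁ T₁ - y₂ T₂| ≤ (S + (r + e + L * S)) / (s₁ * ε) *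
      Real.exp (m * D / (4 * S) * (1 / ε) ^ 2) * Δ := by
  rcases le_total (x₂ 0) (x₁ 0) with h | h
  · exact P.slow_contraction_aux h₁ h₂ hT₁ hT₂ hx₂ h hx₁' hy₁ hy₂ hxT₁ hxT₂ hb₁ hb₂ hD hsm hsm'
      hΔx hΔy
  · rw [abs_sub_comm]
    rw [abs_sub_comm] at hΔx hΔy
    exact P.slow_contraction_aux h₂ h₁ hT₂ hT₁ hx₁ h hx₂' hy₂ hy₁ hxT₂ hxT₁ hb₂ hb₁ hD hsm hsm'
      hΔx hΔy

end IsProfile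

/-- The strong contraction along the slow branch beats the expansion elsewhere. -/
lemma eventually_contraction_factor_le {K c L T s₁ : ℝ} (hK : 0 ≤ K) (hc : c < 0) (hs₁ : 0 < s₁) :
    ∀ᶠ ε in nhdsWithin 0 (Set.Ioi (0 : ℝ)),
      K / (s₁ * ε) * Real.exp (c * (1 / ε) ^ 2) * Real.exp ((1 + L / ε) * T) ≤ 1 / 2 := by
  have hv : Filter.Tendsto (fun ε : ℝ => ε⁻¹) (nhdsWithin 0 (Set.Ioi (0 : ℝ))) Filter.atTop :=
    tendsto_inv_nhdsGT_zero
  have h1 : Filter.Tendsto (fun v : ℝ => v * ((L * T + 1) + c * v) + T) Filter.atTop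
      Filter.atBot := by
    refine Filter.tendsto_atBot_add_const_right _ _ ?_
    exact Filter.tendsto_id.atTop_mul_atBot₀
      (Filter.tendsto_atBot_add_const_left _ _ (Filter.tendsto_id.const_mul_atTop_of_neg hc))
  have h2 := ((Real.tendsto_exp_atBot.comp (h1.comp hv)).const_mul (K / s₁))
  rw [mul_zero] at h2
  filter_upwards [h2.eventually (gt_mem_nhds (show (0 : ℝ) < 1 / 2 by norm_num)),
    self_mem_nhdsWithin] with ε hε hε0
  have hε0' : (0 : ℝ) < ε := hε0
  refine le_trans ?_ hε.le
  have hle : ε⁻¹ ≤ Real.exp ε⁻¹ := by linarith [Real.add_one_le_exp ε⁻¹]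
  have hKs : 0 ≤ K / s₁ := div_nonneg hK hs₁.le
  calc K / (s₁ * ε) * Real.exp (c * (1 / ε) ^ 2) * Real.exp ((1 + L / ε) * T)
      = K / s₁ * (ε⁻¹ * (Real.exp (c * (1 / ε) ^ 2) * Real.exp ((1 + L / ε) * T))) := by
        field_simp
    _ ≤ K / s₁ * (Real.exp ε⁻¹ *
          (Real.exp (c * (1 / ε) ^ 2) * Real.exp ((1 + L / ε) * T))) := by
        gcongr
    _ = _ := by
        rw [← Real.exp_add, ← Real.exp_add]
        simp only [Function.comp]
        congr 2
        field_simp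
        ring

lemma IsTraj.eq_of_lipschitz {G x₁ y₁ x₂ y₂ : ℝ → ℝ} {K : ℝ} (hK : 0 ≤ K)
    (hG : ∀ y z, |G y - G z| ≤ K * |y - z|) (h₁ : IsTraj G x₁ y₁) (h₂ : IsTraj G x₂ y₂)
    {t₀ : ℝ} (hx : x₁ t₀ = x₂ t₀) (hy : y₁ t₀ = y₂ t₀) (t : ℝ) :
    x₁ t = x₂ t ∧ y₁ t = y₂ t := by
  have key := ODE_solution_unique_univ (v := fun _ (p : ℝ × ℝ) => (p.2, -p.1 + G p.2))
    (s := fun _ => {p : ℝ × ℝ | p.2 ∈ Set.univ})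
    (f := fun t => (x₁ t, y₁ t)) (g := fun t => (x₂ t, y₂ t)) (t₀ := t₀)
    (fun _ => lipschitzOnWith_field hK fun y _ z _ => hG y z)
    (fun t => ⟨(h₁.1 t).prodMk (h₁.2 t), Set.mem_univ _⟩)
    (fun t => ⟨(h₂.1 t).prodMk (h₂.2 t), Set.mem_univ _⟩) (by simp [hx, hy])
  have := congrFun key t
  simpa using this

lemma exists_isTraj {G : ℝ → ℝ} {K : ℝ} (hK : 0 ≤ K) (hc : ContDiff ℝ 1 G)
    (hG : ∀ y z, |G y - G z| ≤ K * |y - z|) (x₀ y₀ : ℝ) :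
    ∃ x y, IsTraj G x y ∧ x 0 = x₀ ∧ y 0 = y₀ := by
  have hf : ContDiff ℝ 1 (fun p : ℝ × ℝ => (p.2, -p.1 + G p.2)) :=
    contDiff_snd.prodMk (contDiff_fst.neg.add (hc.comp contDiff_snd))
  have hl : LipschitzWith (Real.toNNReal (1 + K)) (fun p : ℝ × ℝ => (p.2, -p.1 + G p.2)) := by
    rw [← lipschitzOnWith_univ]
    simpa using lipschitzOnWith_field (s := Set.univ) hK fun y _ z _ => hG y z
  obtain ⟨q, hq0, hq⟩ := exists_global_solution hf hl (x₀, y₀)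
  refine ⟨fun t => (q t).1, fun t => (q t).2, ⟨fun t => ?_, fun t => ?_⟩,
    by simp [hq0], by simp [hq0]⟩
  · exact hasFDerivAt_fst.comp_hasDerivAt t (hq t)
  · exact hasFDerivAt_snd.comp_hasDerivAt t (hq t)

/-- A trajectory starting on the fold section traces out a neighbourhood of the singular cycle
during `[0, T]`. -/
structure TracesCycle (τ X D δ : ℝ) (a b x y : ℝ → ℝ) (T : ℝ) : Prop where
  pos : 0 < T
  near : ∀ t ∈ Set.Icc 0 T, NearCycle τ X D δ a b (x t) (y t)
  cover_arc : ∀ s ∈ Set.Icc 0 τ, ∃ t ∈ Set.Icc 0 T, |x t - a s| ≤ δ ∧ |y t - b s| ≤ δ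
  cover_segment : ∀ ξ ∈ Set.Icc D X, ∃ t ∈ Set.Icc 0 T, |x t - ξ| ≤ δ ∧ |y t| ≤ δ
  ne : ∃ t, x t ≠ x 0

lemma eventually_return {γ μ e X τ D δ : ℝ} {a b : ℝ → ℝ} (r s₁ s₀ S L m : ℝ)
    (A : IsLinArc γ X τ D a b) (hγ : 0 < γ) (heX : e < X) (hX : 0 < X) (hδ : 0 < δ) :
    ∀ᶠ ε in nhdsWithin 0 (Set.Ioi 0), ∀ G : ℝ → ℝ, IsProfile γ μ e X r s₁ s₀ S L m ε G →
      e + ε * s₁ ≤ X - 2 * γ * (ε * s₁) ∧ ∃ T : (ℝ → ℝ) → (ℝ → ℝ) → ℝ,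
      (∀ x y, IsTraj G x y → x 0 = X - 2 * γ * (ε * s₁) → y 0 ∈ Set.Icc (ε * s₁) (ε * S) →
        TracesCycle τ X D δ a b x y (T x y) ∧ x (T x y) = X - 2 * γ * (ε * s₁) ∧
          y (T x y) ∈ Set.Icc (ε * s₁) (ε * S)) ∧
      (∀ x₁ y₁ x₂ y₂, IsTraj G x₁ y₁ → IsTraj G x₂ y₂ → x₁ 0 = X - 2 * γ * (ε * s₁) →
        x₂ 0 = X - 2 * γ * (ε * s₁) → y₁ 0 ∈ Set.Icc (ε * s₁) (ε * S) →
        y₂ 0 ∈ Set.Icc (ε * s₁) (ε * S) →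
        |y₁ (T x₁ y₁) - y₂ (T x₂ y₂)| ≤ 1 / 2 * |y₁ 0 - y₂ 0|) := by
  by_cases hpos : 0 < s₁ ∧ 0 < S ∧ 0 < L ∧ 0 < m ∧ 0 < r ∧ 0 < e
  swap
  · refine Filter.Eventually.of_forall fun ε G P => absurd ?_ hpos
    exact ⟨P.s₁_pos, P.S_pos, P.L_pos, P.m_pos, P.r_pos, P.e_pos⟩
  obtain ⟨hs₁, hS, hL, hm, hr, he⟩ := hpos
  have hD := A.D_neg
  have hK : 0 ≤ S + (r + e + L * S) := by positivity
  have hc : m * D / (4 * S) < 0 :=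
    div_neg_of_neg_of_pos (mul_neg_of_pos_of_neg hm hD) (by positivity)
  filter_upwards [eventually_circuit (μ := μ) r s₁ s₀ S L m A hγ heX hX hδ,
    eventually_contraction_factor_le (L := L) (T := circuitTime γ e X s₁ S L τ) hK hc hs₁,
    eventually_mul_le (s₁ * (1 + 2 * γ)) (sub_pos.2 heX),
    eventually_mul_le (2 * γ * s₀) (d := -D / 8) (by linarith),
    eventually_mul_le (2 * γ * s₁) hX, self_mem_nhdsWithin]
    with ε hcirc hfac h1 h2 h3 hε G P
  have hε : 0 < ε := hε
  refine ⟨by linarith, ?_⟩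
  have H := hcirc G P
  set Xf := X - 2 * γ * (ε * s₁) with hXf
  set Ts := circuitTime γ e X s₁ S L τ with hTs
  have H' : ∀ x y, ∃ T, IsTraj G x y → x 0 = Xf → y 0 ∈ Set.Icc (ε * s₁) (ε * S) →
      (∀ t ∈ Set.Icc 0 Ts, y t ≤ ε * S) ∧ -r ≤ x Ts ∧ x Ts ≤ D / 2 ∧ ε * s₀ ≤ y Ts ∧ Ts < T ∧
      x T = Xf ∧ (∀ t ∈ Set.Icc Ts T, ε * s₁ ≤ y t ∧ y t ≤ ε * S) ∧
      (∀ t ∈ Set.Icc 0 T, NearCycle τ X D δ a b (x t) (y t)) ∧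
      (∀ s ∈ Set.Icc 0 τ, ∃ t ∈ Set.Icc 0 T, |x t - a s| ≤ δ ∧ |y t - b s| ≤ δ) ∧
      (∀ ξ ∈ Set.Icc D X, ∃ t ∈ Set.Icc 0 T, |x t - ξ| ≤ δ ∧ |y t| ≤ δ) := by
    intro x y
    by_cases hxy : IsTraj G x y ∧ x 0 = Xf ∧ y 0 ∈ Set.Icc (ε * s₁) (ε * S)
    · obtain ⟨h, hx, hy⟩ := hxy
      obtain ⟨c1, c2, c3, c4, T, hT, c5, c6, c7, c8, c9⟩ := H x y h hx hy.1 hy.2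
      exact ⟨T, fun _ _ _ => ⟨c1, c2, c3, c4, hT, c5, c6, c7, c8, c9⟩⟩
    · exact ⟨0, fun h hx hy => absurd ⟨h, hx, hy⟩ hxy⟩
  choose T hT using H'
  have hTs0 : 0 ≤ Ts := by
    have := sub_pos.2 heX
    have := A.τ_pos
    rw [hTs, circuitTime]
    positivity
  refine ⟨T, fun x y h hx hy => ?_, fun x₁ y₁ x₂ y₂ h₁ h₂ hx₁ hx₂ hy₁ hy₂ => ?_⟩
  · obtain ⟨c1, c2, c3, c4, hT, c5, c6, c7, c8, c9⟩ := hT x y h hx hy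
    refine ⟨⟨by linarith, c7, c8, c9, Ts, ?_⟩, c5, c6 _ ⟨hT.le, le_rfl⟩⟩
    intro hne
    rw [hne, hx, hXf] at c3
    linarith
  · obtain ⟨c1, c2, c3, c4, hT₁, c5, c6, -⟩ := hT x₁ y₁ h₁ hx₁ hy₁
    obtain ⟨d1, d2, d3, d4, hT₂, d5, d6, -⟩ := hT x₂ y₂ h₂ hx₂ hy₂
    obtain ⟨g1, g2⟩ := P.gronwall h₁ h₂ c1 d1 hTs0 (hx₁.trans hx₂.symm)
    have hs := P.slow_contraction (h₁.shift Ts) (h₂.shift Ts) (T₁ := T x₁ y₁ - Ts)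
      (T₂ := T x₂ y₂ - Ts) (D := D) (Δ := |y₁ 0 - y₂ 0| * Real.exp ((1 + L / ε) * Ts))
      (by linarith) (by linarith) (by simpa using c2) (by simpa using d2) (by simpa using c3)
      (by simpa using d3) (by simpa using c4) (by simpa using d4) (by simpa using c5)
      (by simpa using d5)
      (fun t ht => c6 (t + Ts) ⟨by linarith [ht.1], by linarith [ht.2]⟩)
      (fun t ht => d6 (t + Ts) ⟨by linarith [ht.1], by linarith [ht.2]⟩)
      hD (by linarith) (by linarith) (by simpa using g1) (by simpa using g2)
    simp only [sub_add_cancel] at hs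
    refine hs.trans ?_
    have := mul_le_mul_of_nonneg_right hfac (abs_nonneg (y₁ 0 - y₂ 0))
    calc _ = _ := ?_
      _ ≤ _ := this
    ring

lemma exists_fixedPoint_Icc {f : ℝ → ℝ} {l u : ℝ} (hlu : l ≤ u)
    (hf : ∀ v ∈ Set.Icc l u, f v ∈ Set.Icc l u)
    (hc : ∀ v ∈ Set.Icc l u, ∀ w ∈ Set.Icc l u, |f v - f w| ≤ 1 / 2 * |v - w|) :
    ∃ v ∈ Set.Icc l u, f v = v := by
  have hmap : Set.MapsTo f (Set.Icc l u) (Set.Icc l u) := hf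
  have hcon : ContractingWith (1 / 2) (hmap.restrict f (Set.Icc l u) (Set.Icc l u)) := by
    refine ⟨by rw [← NNReal.coe_lt_coe]; norm_num, LipschitzWith.of_dist_le_mul fun v w => ?_⟩
    have := hc v v.2 w w.2
    simpa [Subtype.dist_eq, Real.dist_eq] using this
  obtain ⟨v, hv, hfv, -⟩ := hcon.exists_fixedPoint' isClosed_Icc.isComplete hmap
    (Set.left_mem_Icc.2 hlu) (edist_ne_top _ _)
  exact ⟨v, hv, hfv⟩

/-- A nonconstant periodic trajectory has a point on the part `x < e` of the axis `y = 0`. -/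
lemma IsTraj.exists_axis_point {G x y : ℝ → ℝ} {K e T : ℝ} (hK : 0 ≤ K)
    (hG : ∀ y z, |G y - G z| ≤ K * |y - z|) (hG0 : G 0 = e) (h : IsTraj G x y) (hT : 0 < T)
    (hx : ∀ t, x (t + T) = x t) (hne : ∃ t s, (x t, y t) ≠ (x s, y s)) :
    ∃ t, x t < e ∧ y t = 0 := by
  obtain ⟨t₀, -, hmin⟩ := isCompact_Icc.exists_isMinOn (Set.nonempty_Icc.2 hT.le)
    h.continuous_fst.continuousOn
  have hper : Function.Periodic x T := hx
  have hmin' : ∀ t, x t₀ ≤ x t := by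
    intro t
    obtain ⟨s, hs, hst⟩ := hper.exists_mem_Ico₀ hT t
    rw [hst]
    exact hmin ⟨hs.1, hs.2.le⟩
  have hy0 : y t₀ = 0 :=
    IsLocalMin.hasDerivAt_eq_zero (Filter.Eventually.of_forall hmin') (h.1 t₀)
  refine ⟨t₀, lt_of_not_ge fun hge => ?_, hy0⟩
  rcases hge.eq_or_lt with heq | hlt
  · have hconst : IsTraj G (fun _ => e) (fun _ => 0) :=
      ⟨fun t => hasDerivAt_const _ _, fun t => by simpa [hG0] using hasDerivAt_const t (0 : ℝ)⟩
    obtain ⟨t, s, hts⟩ := hne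
    have H := h.eq_of_lipschitz hK hG hconst (t₀ := t₀) heq.symm hy0
    exact hts (by simp [(H t).1, (H t).2, (H s).1, (H s).2])
  · have hd := h.shift t₀
    have hneg : HasDerivAt (fun t => -y (t + t₀)) (x t₀ - e) 0 := by
      have := (hd.2 0).neg
      simp only [zero_add, hy0, hG0] at this
      rw [show x t₀ - e = -(-x t₀ + e) by ring]
      exact this
    have hp := eventually_pos_of_hasDerivAt hneg (by simp [hy0]) (sub_pos.2 hlt)
    obtain ⟨c, hc, hsub⟩ := (mem_nhdsGT_iff_exists_Ioo_subset).1 hp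
    have hc : 0 < c := hc
    have hlt' : x (c / 2 + t₀) < x (0 + t₀) := by
      refine strictAntiOn_of_deriv_neg (f := fun t => x (t + t₀)) (convex_Icc 0 (c / 2))
        hd.continuous_fst.continuousOn ?_ ⟨le_rfl, by linarith⟩ ⟨by linarith, le_rfl⟩ (by linarith)
      intro t ht
      rw [interior_Icc] at ht
      rw [(hd.1 t).deriv]
      have := hsub (show t ∈ Set.Ioo 0 c from ⟨ht.1, by linarith [ht.2]⟩)
      simp only [Set.mem_ofPred_eq] at this
      linarith
    have := hmin' (c / 2 + t₀)
    rw [zero_add] at hlt'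
    linarith

lemma eventually_unique_cycle {γ μ e X τ D δ : ℝ} {a b : ℝ → ℝ} (r s₁ s₀ S L m : ℝ)
    (A : IsLinArc γ X τ D a b) (hγ : 0 < γ) (heX : e < X) (hX : 0 < X) (hδ : 0 < δ) :
    ∀ᶠ ε in nhdsWithin 0 (Set.Ioi 0), ∀ (G : ℝ → ℝ) (K : ℝ), 0 ≤ K →
      IsProfile γ μ e X r s₁ s₀ S L m ε G → ContDiff ℝ 1 G →
      (∀ y z, |G y - G z| ≤ K * |y - z|) →
      ∃ x y T, IsTraj G x y ∧ (∀ t, x (t + T) = x t ∧ y (t + T) = y t) ∧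
        TracesCycle τ X D δ a b x y T ∧
        ∀ x' y' T', IsTraj G x' y' → 0 < T' → (∀ t, x' (t + T') = x' t ∧ y' (t + T') = y' t) →
          (∃ t s, (x' t, y' t) ≠ (x' s, y' s)) → (∀ t, -r ≤ x' t) →
          ∃ c, ∀ t, x' (t + c) = x t ∧ y' (t + c) = y t := by
  filter_upwards [eventually_return (μ := μ) r s₁ s₀ S L m A hγ heX hX hδ]
    with ε hret G K hK P hGc hG
  obtain ⟨hsm, T, hT, hcon⟩ := hret G P
  set Xf := X - 2 * γ * (ε * s₁) with hXf
  have hF : ∀ v, ∃ x y, IsTraj G x y ∧ x 0 = Xf ∧ y 0 = v := exists_isTraj hK hGc hG Xf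
  choose x y h hx hy using hF
  have hmem : ∀ v ∈ Set.Icc (ε * s₁) (ε * S), y v 0 ∈ Set.Icc (ε * s₁) (ε * S) := by
    intro v hv
    rwa [hy]
  obtain ⟨v, hv, hfix⟩ := exists_fixedPoint_Icc (f := fun v => y v (T (x v) (y v)))
    (P.εs₁_lt.trans P.εs₀_lt).le (fun v hv => (hT _ _ (h v) (hx v) (hmem v hv)).2.2)
    (fun v hv w hw => by
      have := hcon _ _ _ _ (h v) (h w) (hx v) (hx w) (hmem v hv) (hmem w hw)
      rwa [hy, hy] at this)
  obtain ⟨htr, hxT, -⟩ := hT _ _ (h v) (hx v) (hmem v hv)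
  refine ⟨x v, y v, T (x v) (y v), h v, fun t => ?_, htr, ?_⟩
  · exact ((h v).shift _).eq_of_lipschitz hK hG (h v) (t₀ := 0) (by simp [hxT, hx])
      (by simpa [hy] using hfix) t
  · intro x' y' T' h' hT' hper hne hr
    obtain ⟨t₁, hxt₁, hyt₁⟩ := h'.exists_axis_point hK hG P.zero hT' (fun t => (hper t).1) hne
    obtain ⟨t₂, -, hxt₂, hyt₂⟩ := P.reach_fold_of_axis (h'.shift t₁) (by simpa using hr t₁)
      (by simpa using hxt₁) (by simpa using hyt₁) hsm
    let Z : Set ℝ := Set.Icc 0 T' ∩ {t | x' t = Xf ∧ y' t ∈ Set.Icc (ε * s₁) (ε * S)}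
    have hreduce : ∀ t, x' t = Xf → y' t ∈ Set.Icc (ε * s₁) (ε * S) →
        ∃ s ∈ Z, y' s = y' t := by
      intro t ht ht'
      have hp : Function.Periodic (fun t => (x' t, y' t)) T' :=
        fun t => Prod.ext (hper t).1 (hper t).2
      obtain ⟨s, hs, hst⟩ := hp.exists_mem_Ico₀ hT' t
      simp only [Prod.mk.injEq] at hst
      refine ⟨s, ⟨⟨hs.1, hs.2.le⟩, ?_, ?_⟩, hst.2.symm⟩
      · rw [← hst.1, ht]
      · rw [← hst.2]; exact ht'
    have hZ : IsCompact Z := by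
      refine isCompact_Icc.inter_right (IsClosed.inter ?_ ?_)
      · exact isClosed_eq h'.continuous_fst continuous_const
      · exact isClosed_Icc.preimage h'.continuous_snd
    obtain ⟨s₂, hs₂, -⟩ := hreduce _ hxt₂ hyt₂
    obtain ⟨s, hs, hmin⟩ := hZ.exists_isMinOn ⟨s₂, hs₂⟩ (f := fun t => |y' t - v|)
      ((h'.continuous_snd.sub continuous_const).abs.continuousOn)
    have hsh := h'.shift s
    have hx0 : x' (0 + s) = Xf := by simpa using hs.2.1
    have hy0 : y' (0 + s) ∈ Set.Icc (ε * s₁) (ε * S) := by simpa using hs.2.2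
    obtain ⟨-, hxr, hyr⟩ := hT _ _ hsh hx0 hy0
    obtain ⟨w, hw, hyw⟩ := hreduce _ hxr hyr
    have h1 := hcon _ _ _ _ hsh (h v) hx0 (hx v) hy0 (hmem v hv)
    have h2 : |y' s - v| ≤ |y' w - v| := hmin hw
    rw [hfix, hy, zero_add, ← hyw] at h1
    have h3 : |y' s - v| ≤ 0 := by linarith
    have h4 : y' s = v := by linarith [abs_nonpos_iff.1 h3]
    exact ⟨s, hsh.eq_of_lipschitz hK hG (h v) (t₀ := 0) (hx0.trans (hx v).symm)
      (by rw [hy, zero_add, h4])⟩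

/-- The nonlinearity of the Hester system in the rescaled variable `s = y / ε`. -/
noncomputable def expDiff (α κ s : ℝ) : ℝ := Real.exp s - κ * Real.exp ((1 + α) * s)

/-- The derivative of `expDiff`. -/
noncomputable def expDiffDeriv (α κ s : ℝ) : ℝ :=
  Real.exp s - κ * ((1 + α) * Real.exp ((1 + α) * s))

/-- The point at which `expDiff` attains its maximum. -/
noncomputable def foldPoint (α κ : ℝ) : ℝ := -Real.log (κ * (1 + α)) / α

/-- The zero of `expDiff`. -/
noncomputable def zeroPoint (α κ : ℝ) : ℝ := -Real.log κ / α

section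

variable {α κ s : ℝ}

lemma hasDerivAt_expDiff (α κ s : ℝ) : HasDerivAt (expDiff α κ) (expDiffDeriv α κ s) s := by
  have h1 : HasDerivAt (fun s : ℝ => (1 + α) * s) (1 + α) s := by
    simpa using (hasDerivAt_id s).const_mul (1 + α)
  have := (Real.hasDerivAt_exp s).sub ((h1.exp).const_mul κ)
  unfold expDiffDeriv
  rw [mul_comm (1 + α)]
  exact this

lemma continuous_expDiffDeriv (α κ : ℝ) : Continuous (expDiffDeriv α κ) := by
  unfold expDiffDeriv
  fun_prop

lemma expDiff_zero (α κ : ℝ) : expDiff α κ 0 = 1 - κ := by simp [expDiff]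

lemma expDiff_eq (α κ s : ℝ) : expDiff α κ s = Real.exp s * (1 - κ * Real.exp (α * s)) := by
  rw [expDiff, show (1 + α) * s = s + α * s by ring, Real.exp_add]
  ring

lemma expDiffDeriv_eq (α κ s : ℝ) :
    expDiffDeriv α κ s = Real.exp s * (1 - κ * (1 + α) * Real.exp (α * s)) := by
  rw [expDiffDeriv, show (1 + α) * s = s + α * s by ring, Real.exp_add]
  ring

lemma mul_exp_foldPoint (hα : 0 < α) (hκ : 0 < κ) :
    κ * (1 + α) * Real.exp (α * foldPoint α κ) = 1 := by
  have h : 0 < κ * (1 + α) := by positivity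
  rw [foldPoint, mul_div_cancel₀ _ hα.ne', Real.exp_neg, Real.exp_log h]
  exact mul_inv_cancel₀ h.ne'

lemma mul_exp_zeroPoint (hα : 0 < α) (hκ : 0 < κ) :
    κ * Real.exp (α * zeroPoint α κ) = 1 := by
  rw [zeroPoint, mul_div_cancel₀ _ hα.ne', Real.exp_neg, Real.exp_log hκ]
  exact mul_inv_cancel₀ hκ.ne'

lemma foldPoint_pos (hα : 0 < α) (hκ : 0 < κ) (hκα : κ * (1 + α) < 1) : 0 < foldPoint α κ :=
  div_pos (neg_pos.2 (Real.log_neg (by positivity) hκα)) hα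

lemma foldPoint_lt_zeroPoint (hα : 0 < α) (hκ : 0 < κ) : foldPoint α κ < zeroPoint α κ := by
  have : Real.log κ < Real.log (κ * (1 + α)) := Real.log_lt_log hκ (by nlinarith)
  exact div_lt_div_of_pos_right (by linarith) hα

lemma expDiffDeriv_nonneg (hα : 0 < α) (hκ : 0 < κ) (hs : s ≤ foldPoint α κ) :
    0 ≤ expDiffDeriv α κ s := by
  rw [expDiffDeriv_eq]
  refine mul_nonneg (Real.exp_pos _).le ?_
  have h : Real.exp (α * s) ≤ Real.exp (α * foldPoint α κ) := by gcongr
  have h' : 0 < κ * (1 + α) := by positivity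
  linarith [mul_exp_foldPoint hα hκ, mul_le_mul_of_nonneg_left h h'.le]

lemma expDiffDeriv_nonpos (hα : 0 < α) (hκ : 0 < κ) (hs : foldPoint α κ ≤ s) :
    expDiffDeriv α κ s ≤ 0 := by
  rw [expDiffDeriv_eq]
  refine mul_nonpos_of_nonneg_of_nonpos (Real.exp_pos _).le ?_
  have h : Real.exp (α * foldPoint α κ) ≤ Real.exp (α * s) := by gcongr
  have h' : 0 < κ * (1 + α) := by positivity
  linarith [mul_exp_foldPoint hα hκ, mul_le_mul_of_nonneg_left h h'.le]

lemma expDiffDeriv_le_neg (hα : 0 < α) (hκ : 0 < κ) (h0 : 0 ≤ s) (hs : zeroPoint α κ ≤ s) :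
    expDiffDeriv α κ s ≤ -α := by
  rw [expDiffDeriv_eq]
  have h1 : 1 ≤ κ * Real.exp (α * s) := by
    rw [← mul_exp_zeroPoint hα hκ]
    gcongr
  have h2 : 1 ≤ Real.exp s := Real.one_le_exp h0
  have h3 : 1 - κ * (1 + α) * Real.exp (α * s) ≤ -α := by nlinarith
  nlinarith

lemma abs_expDiffDeriv_le (hα : 0 < α) (hκ : 0 < κ) {u : ℝ} (hs : s ≤ u) :
    |expDiffDeriv α κ s| ≤ Real.exp u + κ * ((1 + α) * Real.exp ((1 + α) * u)) := by
  have h1 : Real.exp s ≤ Real.exp u := by gcongr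
  have h2 : κ * ((1 + α) * Real.exp ((1 + α) * s)) ≤ κ * ((1 + α) * Real.exp ((1 + α) * u)) := by
    gcongr
  have h3 : 0 < κ * ((1 + α) * Real.exp ((1 + α) * s)) := by positivity
  have h4 := Real.exp_pos s
  rw [expDiffDeriv, abs_le]
  constructor <;> linarith

lemma expDiff_mono (hα : 0 < α) (hκ : 0 < κ) {t : ℝ} (hst : s ≤ t) (ht : t ≤ foldPoint α κ) :
    expDiff α κ s ≤ expDiff α κ t := by
  have := mul_le_sub_of_le_deriv (c := 0) (hasDerivAt_expDiff α κ) hst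
    (fun u hu => expDiffDeriv_nonneg hα hκ (hu.2.le.trans ht))
  linarith

lemma expDiff_anti (hα : 0 < α) (hκ : 0 < κ) {t : ℝ} (hs : foldPoint α κ ≤ s) (hst : s ≤ t) :
    expDiff α κ t ≤ expDiff α κ s := by
  have := sub_le_mul_of_deriv_le (c := 0) (hasDerivAt_expDiff α κ) hst
    (fun u hu => expDiffDeriv_nonpos hα hκ (hs.trans hu.1.le))
  linarith

lemma expDiff_le (hα : 0 < α) (hκ : 0 < κ) (s : ℝ) :
    expDiff α κ s ≤ expDiff α κ (foldPoint α κ) := by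
  rcases le_total s (foldPoint α κ) with h | h
  · exact expDiff_mono hα hκ h le_rfl
  · exact expDiff_anti hα hκ le_rfl h

lemma expDiff_zeroPoint (hα : 0 < α) (hκ : 0 < κ) : expDiff α κ (zeroPoint α κ) = 0 := by
  rw [expDiff_eq, mul_exp_zeroPoint hα hκ]
  ring

lemma expDiff_nonneg (hα : 0 < α) (hκ : 0 < κ) (hs : s ≤ zeroPoint α κ) : 0 ≤ expDiff α κ s := by
  rw [expDiff_eq]
  refine mul_nonneg (Real.exp_pos _).le ?_
  rw [← mul_exp_zeroPoint hα hκ, ← mul_sub]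
  have : Real.exp (α * s) ≤ Real.exp (α * zeroPoint α κ) := by gcongr
  exact mul_nonneg hκ.le (by linarith)

lemma expDiff_le_exp (hκ : 0 < κ) (s : ℝ) : expDiff α κ s ≤ Real.exp s := by
  have : 0 < κ * Real.exp ((1 + α) * s) := by positivity
  rw [expDiff]
  linarith

lemma exists_expDiff_ge_line (hα : 0 < α) (hκ : 0 < κ) (hκα : κ * (1 + α) < 1) :
    ∃ c > 0, ∀ s ∈ Set.Icc 0 (foldPoint α κ), expDiff α κ 0 + c * s ≤ expDiff α κ s := by
  have h1 := foldPoint_pos hα hκ hκα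
  set s₁ := foldPoint α κ with hs₁
  set c : ℝ := 1 - κ * (1 + α) * Real.exp (α * (s₁ / 2)) with hc
  have hκα0 : 0 < κ * (1 + α) := by positivity
  have hc0 : 0 < c := by
    have : Real.exp (α * (s₁ / 2)) < Real.exp (α * s₁) := by
      refine Real.exp_lt_exp.2 (mul_lt_mul_of_pos_left (by linarith) hα)
    have := mul_lt_mul_of_pos_left this hκα0
    have := mul_exp_foldPoint hα hκ
    linarith
  have key : ∀ s ∈ Set.Icc 0 (s₁ / 2), c * s ≤ expDiff α κ s - expDiff α κ 0 := by
    intro s hs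
    have := mul_le_sub_of_le_deriv (c := c) (hasDerivAt_expDiff α κ) hs.1 ?_
    · simpa using this
    · intro t ht
      rw [expDiffDeriv_eq]
      have h2 : 1 ≤ Real.exp t := Real.one_le_exp ht.1.le
      have h3 : c ≤ 1 - κ * (1 + α) * Real.exp (α * t) := by
        have : Real.exp (α * t) ≤ Real.exp (α * (s₁ / 2)) := by
          have := ht.2.le.trans hs.2
          gcongr
        have := mul_le_mul_of_nonneg_left this hκα0.le
        linarith
      nlinarith
  refine ⟨c / 2, by linarith, fun s hs => ?_⟩
  have hcs : 0 ≤ c * s := mul_nonneg hc0.le hs.1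
  rcases le_total s (s₁ / 2) with h | h
  · have := key s ⟨hs.1, h⟩
    linarith
  · have h2 := key (s₁ / 2) ⟨by linarith, le_rfl⟩
    have h3 := expDiff_mono hα hκ h hs.2
    have h4 : c * s ≤ c * s₁ := mul_le_mul_of_nonneg_left hs.2 hc0.le
    linarith

lemma fold_value_eq (hα : 0 < α) (hκ : 0 < κ) (μ : ℝ) :
    μ * α / ((1 + α) ^ ((1 + α) / α) * κ ^ (1 / α)) = μ * expDiff α κ (foldPoint α κ) := by
  have h1 : 0 < 1 + α := by linarith
  have hx : κ * Real.exp (α * foldPoint α κ) = 1 / (1 + α) := by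
    have := mul_exp_foldPoint hα hκ
    field_simp
    linarith
  have h2 : Real.exp (foldPoint α κ) * ((1 + α) ^ (1 / α) * κ ^ (1 / α)) = 1 := by
    rw [← Real.mul_rpow h1.le hκ.le, Real.rpow_def_of_pos (by positivity), ← Real.exp_add,
      foldPoint, mul_comm κ]
    rw [Real.exp_eq_one_iff]
    ring
  have h3 : (1 + α) ^ ((1 + α) / α) = (1 + α) ^ (1 / α) * (1 + α) := by
    rw [show (1 + α) / α = 1 / α + 1 by field_simp, Real.rpow_add_one h1.ne']
  have h4 : 0 < (1 + α) ^ (1 / α) := Real.rpow_pos_of_pos h1 _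
  have h5 : 0 < κ ^ (1 / α) := Real.rpow_pos_of_pos hκ _
  rw [expDiff_eq, hx, h3, div_eq_iff (by positivity)]
  calc μ * α = μ * α * (Real.exp (foldPoint α κ) * ((1 + α) ^ (1 / α) * κ ^ (1 / α))) := by
        rw [h2, mul_one]
    _ = _ := by field_simp; ring

end

/-- The nonlinear part of the second component of the Hester vector field. -/
noncomputable def hesterForce (γ α μ κ ε y : ℝ) : ℝ := -2 * γ * y + μ * expDiff α κ (y / ε)

lemma hasDerivAt_hesterForce (γ α μ κ ε y : ℝ) :
    HasDerivAt (hesterForce γ α μ κ ε) (-2 * γ + μ / ε * expDiffDeriv α κ (y / ε)) y := by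
  have h1 : HasDerivAt (fun y : ℝ => y / ε) (1 / ε) y := (hasDerivAt_id y).div_const ε
  have h2 := (((hasDerivAt_expDiff α κ (y / ε)).comp y h1).const_mul μ)
  have h3 : HasDerivAt (fun y : ℝ => -2 * γ * y) (-2 * γ) y := by
    simpa using (hasDerivAt_id y).const_mul (-2 * γ)
  rw [show μ / ε * expDiffDeriv α κ (y / ε) = μ * (expDiffDeriv α κ (y / ε) * (1 / ε)) by ring]
  exact h3.add h2

lemma IsProfile.congr {γ μ e X r s₁ s₀ S L m ε : ℝ} {F G : ℝ → ℝ}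
    (P : IsProfile γ μ e X r s₁ s₀ S L m ε F) (h : ∀ y ≤ ε * S, G y = F y) :
    IsProfile γ μ e X r s₁ s₀ S L m ε G where
  __ := P
  lip y hy z hz := by rw [h y hy, h z hz]; exact P.lip y hy z hz
  zero := by rw [h 0 (mul_pos P.ε_pos P.S_pos).le]; exact P.zero
  le_X y hy hy' := by rw [h y hy']; exact P.le_X y hy hy'
  ge_line y hy hy' := by
    rw [h y (hy'.trans (P.εs₁_lt.trans P.εs₀_lt).le)]; exact P.ge_line y hy hy'
  fold := by rw [h _ (P.εs₁_lt.trans P.εs₀_lt).le]; exact P.fold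
  anti y z hy hyz hz := by rw [h y (hyz.trans hz), h z hz]; exact P.anti y z hy hyz hz
  anti_strong y z hy hyz hz := by
    rw [h y (hyz.trans hz), h z hz]; exact P.anti_strong y z hy hyz hz
  at_s₀ := by rw [h _ P.εs₀_lt.le]; exact P.at_s₀
  ge_s₀ y hy hy' := by rw [h y (hy'.trans P.εs₀_lt.le)]; exact P.ge_s₀ y hy hy'
  at_S := by rw [h _ le_rfl]; exact P.at_S
  neg_lower y hy := by
    rw [h y (hy.trans (mul_pos P.ε_pos P.S_pos).le)]; exact P.neg_lower y hy
  neg_upper y hy := by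
    rw [h y (hy.trans (mul_pos P.ε_pos P.S_pos).le)]; exact P.neg_upper y hy
  neg_upper' y hy := by
    rw [h y (hy.trans (mul_pos P.ε_pos P.S_pos).le)]; exact P.neg_upper' y hy

lemma abs_sub_le_of_abs_deriv_le {f f' : ℝ → ℝ} {s : Set ℝ} {K : ℝ} (hs : Convex ℝ s)
    (hf : ∀ t, HasDerivAt f (f' t) t) (hK : ∀ t ∈ s, |f' t| ≤ K) {y z : ℝ} (hy : y ∈ s)
    (hz : z ∈ s) : |f y - f z| ≤ K * |y - z| :=
  hs.norm_image_sub_le_of_norm_hasDerivWithin_le (fun t _ => (hf t).hasDerivWithinAt) hK hz hy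

/-- A function that is differentiable with bounded continuous derivative on `(-∞, r]` extends to
a globally Lipschitz function of class `C¹`. -/
lemma exists_lipschitz_extension {F F' : ℝ → ℝ} {r K : ℝ} (hF : ∀ y, HasDerivAt F (F' y) y)
    (hF' : Continuous F') (hK : ∀ y ≤ r, |F' y| ≤ K) :
    ∃ G : ℝ → ℝ, ContDiff ℝ 1 G ∧ (∀ y z, |G y - G z| ≤ K * |y - z|) ∧ ∀ y ≤ r, G y = F y := by
  have hc : Continuous fun t => F' (min t r) := hF'.comp (continuous_id.min continuous_const)
  let G : ℝ → ℝ := fun y => F r + ∫ t in r..y, F' (min t r)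
  have hG : ∀ y, HasDerivAt G (F' (min y r)) y := fun y =>
    (hc.integral_hasStrictDerivAt r y).hasDerivAt.const_add _
  refine ⟨G, ?_, fun y z => ?_, fun y hy => ?_⟩
  · rw [contDiff_one_iff_deriv]
    refine ⟨fun y => (hG y).differentiableAt, ?_⟩
    rwa [show deriv G = fun t => F' (min t r) from funext fun y => (hG y).deriv]
  · exact abs_sub_le_of_abs_deriv_le convex_univ hG (fun t _ => hK _ (min_le_right _ _))
      (Set.mem_univ _) (Set.mem_univ _)
  · have : ∫ t in r..y, F' (min t r) = ∫ t in r..y, F' t := by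
      refine intervalIntegral.integral_congr fun t ht => ?_
      rw [Set.uIcc_of_ge hy] at ht
      simp only [min_eq_left ht.2]
    simp only [G]
    rw [this, intervalIntegral.integral_eq_sub_of_hasDerivAt (fun t _ => hF t)
      (hF'.intervalIntegrable _ _)]
    ring

lemma eventually_isProfile {γ α μ κ r : ℝ} (hγ : 0 < γ) (hα : 0 < α) (hμ : 0 < μ) (hκ : 0 < κ)
    (hκα : κ * (1 + α) < 1) (hr : μ * expDiff α κ (foldPoint α κ) + 1 ≤ r) :
    μ * (1 - κ) < μ * expDiff α κ (foldPoint α κ) ∧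
    ∃ S L m, ∀ᶠ ε in nhdsWithin 0 (Set.Ioi 0), ∃ G K, 0 ≤ K ∧
      IsProfile γ μ (μ * (1 - κ)) (μ * expDiff α κ (foldPoint α κ)) r (foldPoint α κ)
        (zeroPoint α κ) S L m ε G ∧ ContDiff ℝ 1 G ∧ (∀ y z, |G y - G z| ≤ K * |y - z|) ∧
        ∀ y ≤ r, G y = hesterForce γ α μ κ ε y := by
  have hs₁ := foldPoint_pos hα hκ hκα
  have hs₁₀ := foldPoint_lt_zeroPoint hα hκ
  obtain ⟨c, hc, hline⟩ := exists_expDiff_ge_line hα hκ hκα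
  have hfold := fun s => expDiff_le hα hκ s
  have hs₀0 := expDiff_zeroPoint hα hκ
  have hκ1 : κ < 1 := by nlinarith
  have hanti : ∀ s t, foldPoint α κ ≤ s → s ≤ t → expDiff α κ t ≤ expDiff α κ s :=
    fun s t => expDiff_anti hα hκ
  have hmono : ∀ s ≤ 0, expDiff α κ s ≤ 1 - κ := fun s hs => by
    rw [← expDiff_zero α κ]
    exact expDiff_mono hα hκ hs hs₁.le
  set s₁ := foldPoint α κ with hs₁def
  set s₀ := zeroPoint α κ with hs₀def
  have heX : μ * (1 - κ) < μ * expDiff α κ s₁ := by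
    refine mul_lt_mul_of_pos_left ?_ hμ
    have := hline s₁ ⟨hs₁.le, le_rfl⟩
    rw [expDiff_zero] at this
    have := mul_pos hc hs₁
    linarith
  have he : 0 < μ * (1 - κ) := mul_pos hμ (by linarith)
  have hr0 : 0 < r := by linarith
  have hstrong : ∀ s t, s₀ ≤ s → s ≤ t → expDiff α κ t - expDiff α κ s ≤ -α * (t - s) := by
    intro s t hs hst
    exact sub_le_mul_of_deriv_le (hasDerivAt_expDiff α κ) hst fun u hu =>
      expDiffDeriv_le_neg hα hκ (by linarith [hu.1]) (hs.trans hu.1.le)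
  set S := s₀ + (r + 1) / (μ * α) with hS
  have hS₀ : s₀ < S := by
    rw [hS]
    have : 0 < (r + 1) / (μ * α) := by positivity
    linarith
  have hatS : μ * expDiff α κ S ≤ -(r + 1) := by
    have h1 := hstrong s₀ S le_rfl hS₀.le
    rw [hs₀0] at h1
    have h2 := mul_le_mul_of_nonneg_left h1 hμ.le
    have h3 : μ * (-α * (S - s₀)) = -(r + 1) := by
      rw [hS]
      field_simp
      ring
    linarith
  have hSpos : 0 < S := by linarith
  set B := Real.exp S + κ * ((1 + α) * Real.exp ((1 + α) * S)) with hB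
  have hBpos : 0 < B := by positivity
  refine ⟨heX, S, 2 * γ + μ * B, μ * α, ?_⟩
  filter_upwards [self_mem_nhdsWithin, eventually_mul_le 1 zero_lt_one, eventually_mul_le S hr0,
    eventually_mul_le (2 + 2 * γ) (mul_pos hμ hc)] with ε hε hε1 hεS hεc
  have hε : 0 < ε := hε
  rw [mul_one] at hε1
  have hdiv : ∀ s, ε * s / ε = s := fun s => mul_div_cancel_left₀ s hε.ne'
  have hF := hasDerivAt_hesterForce γ α μ κ ε
  have hFc : Continuous fun y => -2 * γ + μ / ε * expDiffDeriv α κ (y / ε) :=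
    continuous_const.add (continuous_const.mul
      ((continuous_expDiffDeriv α κ).comp (continuous_id.div_const ε)))
  have hbound : ∀ u, ∀ y ≤ ε * u, |-2 * γ + μ / ε * expDiffDeriv α κ (y / ε)| ≤
      2 * γ + μ / ε * (Real.exp u + κ * ((1 + α) * Real.exp ((1 + α) * u))) := by
    intro u y hy
    have h1 : y / ε ≤ u := by rwa [div_le_iff₀' hε]
    have h2 := abs_expDiffDeriv_le hα hκ h1
    have h3 : 0 < μ / ε := div_pos hμ hε
    refine (abs_add_le _ _).trans (add_le_add ?_ ?_)
    · rw [abs_mul, abs_of_pos hγ]; norm_num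
    · rw [abs_mul, abs_of_pos h3]
      exact mul_le_mul_of_nonneg_left h2 h3.le
  obtain ⟨G, hGc, hGl, hGF⟩ := exists_lipschitz_extension (r := r) hF hFc
    (fun y hy => hbound (r / ε) y (by rwa [mul_div_cancel₀ _ hε.ne']))
  refine ⟨G, _, by positivity, IsProfile.congr ?_ fun y hy => hGF y (hy.trans hεS), hGc, hGl, hGF⟩
  have hle : ∀ {y s : ℝ}, y ≤ ε * s → y / ε ≤ s := fun hy => by rwa [div_le_iff₀' hε]
  have hge : ∀ {y s : ℝ}, ε * s ≤ y → s ≤ y / ε := fun hy => by rwa [le_div_iff₀' hε]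
  constructor
  · exact hγ
  · exact hμ
  · exact he
  · exact heX
  · exact hr
  · exact hs₁
  · exact hs₁₀
  · exact hS₀
  · positivity
  · positivity
  · exact hε
  · exact hε1
  · intro y hy z hz
    refine (abs_sub_le_of_abs_deriv_le (convex_Iic (ε * S)) hF (fun t ht => hbound S t ht)
      hy hz).trans ?_
    refine mul_le_mul_of_nonneg_right ?_ (abs_nonneg _)
    rw [add_div, ← hB, mul_div_right_comm μ]
    have : 2 * γ ≤ 2 * γ / ε := by
      rw [le_div_iff₀ hε]
      nlinarith
    linarith
  · simp [hesterForce, expDiff_zero]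
  · intro y hy _
    have := mul_le_mul_of_nonneg_left (hfold (y / ε)) hμ.le
    have : 0 ≤ γ * y := by positivity
    rw [hesterForce]
    linarith
  · intro y hy hy'
    have h1 := hline (y / ε) ⟨by positivity, hle hy'⟩
    rw [expDiff_zero] at h1
    have h2 := mul_le_mul_of_nonneg_left h1 hμ.le
    have h3 : (2 + 2 * γ) * y ≤ μ * (c * (y / ε)) := by
      have : μ * (c * (y / ε)) = μ * c * y / ε := by ring
      rw [this, le_div_iff₀ hε]
      nlinarith
    rw [hesterForce]
    linarith
  · rw [hesterForce, hdiv]; ring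
  · intro y z hy hyz _
    have h1 := hanti (y / ε) (z / ε) (hge hy) (by gcongr)
    have h2 := mul_le_mul_of_nonneg_left h1 hμ.le
    have h3 := mul_le_mul_of_nonneg_left hyz hγ.le
    rw [hesterForce, hesterForce]
    linarith
  · intro y z hy hyz _
    have h1 := hstrong (y / ε) (z / ε) (hge hy) (by gcongr)
    have h2 := mul_le_mul_of_nonneg_left h1 hμ.le
    have h3 := mul_le_mul_of_nonneg_left hyz hγ.le
    have h4 : μ * (-α * (z / ε - y / ε)) = -(μ * α / ε) * (z - y) := by ring
    rw [hesterForce, hesterForce]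
    linarith
  · rw [hesterForce, hdiv, hs₀0]; ring
  · intro y hy hy'
    have h1 := mul_nonneg hμ.le (expDiff_nonneg hα hκ (hle hy'))
    have h3 := mul_le_mul_of_nonneg_left hy' hγ.le
    rw [hesterForce]
    linarith
  · rw [hesterForce, hdiv]
    have : 0 < γ * (ε * S) := by positivity
    linarith
  · intro y hy
    have h0 : y / ε ≤ s₀ := (div_nonpos_of_nonpos_of_nonneg hy hε.le).trans (by linarith)
    have h1 := mul_nonneg hμ.le (expDiff_nonneg hα hκ h0)
    rw [hesterForce]
    linarith
  · intro y hy
    have h1 := mul_le_mul_of_nonneg_left (expDiff_le_exp (α := α) hκ (y / ε)) hμ.le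
    rw [hesterForce]
    linarith
  · intro y hy
    have h1 := mul_le_mul_of_nonneg_left
      (hmono (y / ε) (div_nonpos_of_nonpos_of_nonneg hy hε.le)) hμ.le
    rw [hesterForce]
    linarith

lemma hesterField_eq (γ α μ κ ε : ℝ) (p : ℝ × ℝ) :
    hesterField γ α μ κ ε p = (p.2, -p.1 + hesterForce γ α μ κ ε p.2) := by
  rw [hesterField, hesterForce, expDiff, mul_div_assoc]
  congr 1
  ring

lemma IsTraj.hasDerivAt_hesterField {γ α μ κ ε : ℝ} {G x y : ℝ → ℝ} (h : IsTraj G x y) {t : ℝ}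
    (hG : G (y t) = hesterForce γ α μ κ ε (y t)) :
    HasDerivAt (fun t => (x t, y t)) (hesterField γ α μ κ ε (x t, y t)) t := by
  rw [hesterField_eq]
  have := h.2 t
  rw [hG] at this
  exact (h.1 t).prodMk this

lemma isTraj_of_hesterField {γ α μ κ ε : ℝ} {G : ℝ → ℝ} {q : ℝ → ℝ × ℝ}
    (h : ∀ t, HasDerivAt q (hesterField γ α μ κ ε (q t)) t)
    (hG : ∀ t, G (q t).2 = hesterForce γ α μ κ ε (q t).2) :
    IsTraj G (fun t => (q t).1) (fun t => (q t).2) := by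
  refine ⟨fun t => ?_, fun t => ?_⟩
  · exact hasFDerivAt_fst.comp_hasDerivAt t (h t)
  · have := hasFDerivAt_snd.comp_hasDerivAt t (h t)
    rw [hesterField_eq, ← hG] at this
    exact this

section

variable {γ X τ D δ x y : ℝ} {a b : ℝ → ℝ}

lemma IsLinArc.abs_end_le (A : IsLinArc γ X τ D a b) : |D| ≤ X := by
  have := A.abs_fst_le τ A.τ_pos.le
  rwa [A.fst_τ] at this

lemma NearCycle.abs_le_add (A : IsLinArc γ X τ D a b) (hX : 0 < X) (h : NearCycle τ X D δ a b x y) :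
    |x| ≤ X + δ ∧ |y| ≤ X + δ := by
  rcases h with ⟨s, hs, h1, h2⟩ | ⟨ξ, hξ, h1, h2⟩
  · have h3 := A.abs_fst_le s hs.1
    have h4 := A.abs_snd_le s hs.1
    have h5 := abs_sub_abs_le_abs_sub x (a s)
    have h6 := abs_sub_abs_le_abs_sub y (b s)
    constructor <;> linarith
  · have h3 : |ξ| ≤ X := abs_le.2 ⟨by linarith [(abs_le.1 A.abs_end_le).1, hξ.1], hξ.2⟩
    have h5 := abs_sub_abs_le_abs_sub x ξ
    constructor <;> linarith

end

lemma TracesCycle.hausdorffDist_le {τ X D δ T : ℝ} {x y : ℝ → ℝ} {u : ℝ → ℝ × ℝ} (hδ : 0 ≤ δ)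
    (h : TracesCycle τ X D δ (fun t => (u t).1) (fun t => (u t).2) x y T)
    (hper : ∀ t, x (t + T) = x t ∧ y (t + T) = y t) :
    Metric.hausdorffDist (Set.range fun t => (x t, y t))
      ((u '' Set.Icc 0 τ) ∪ (Set.Icc D X ×ˢ ({0} : Set ℝ))) ≤ δ := by
  have hd : ∀ {p q : ℝ × ℝ}, |p.1 - q.1| ≤ δ → |p.2 - q.2| ≤ δ → dist p q ≤ δ := by
    intro p q h1 h2
    rw [Prod.dist_eq, Real.dist_eq, Real.dist_eq]
    exact max_le h1 h2
  refine Metric.hausdorffDist_le_of_mem_dist hδ ?_ ?_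
  · rintro _ ⟨t, rfl⟩
    have hp : Function.Periodic (fun t => (x t, y t)) T :=
      fun t => Prod.ext (hper t).1 (hper t).2
    obtain ⟨s, hs, hst⟩ := hp.exists_mem_Ico₀ h.pos t
    dsimp only
    rw [hst]
    rcases h.near s ⟨hs.1, hs.2.le⟩ with ⟨σ, hσ, h1, h2⟩ | ⟨ξ, hξ, h1, h2⟩
    · exact ⟨u σ, Or.inl ⟨σ, hσ, rfl⟩, hd h1 h2⟩
    · exact ⟨(ξ, 0), Or.inr ⟨hξ, rfl⟩, hd h1 (by simpa using h2)⟩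
  · rintro _ (⟨σ, hσ, rfl⟩ | ⟨hξ, hz⟩)
    · obtain ⟨t, -, h1, h2⟩ := h.cover_arc σ hσ
      refine ⟨_, ⟨t, rfl⟩, hd ?_ ?_⟩
      · rwa [abs_sub_comm]
      · rwa [abs_sub_comm]
    · obtain ⟨t, -, h1, h2⟩ := h.cover_segment _ hξ
      refine ⟨_, ⟨t, rfl⟩, hd ?_ ?_⟩
      · rwa [abs_sub_comm]
      · rw [Set.mem_singleton_iff.1 hz, abs_sub_comm]
        simpa using h2

lemma eventually_hester_cycle {γ α μ κ r τ D δ : ℝ} {u : ℝ → ℝ × ℝ} (hγ : 0 < γ) (hα : 0 < α)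
    (hμ : 0 < μ) (hκ : 0 < κ) (hκα : κ * (1 + α) < 1)
    (hX : 0 < μ * expDiff α κ (foldPoint α κ)) (hr : μ * expDiff α κ (foldPoint α κ) + 1 ≤ r)
    (A : IsLinArc γ (μ * expDiff α κ (foldPoint α κ)) τ D (fun t => (u t).1) (fun t => (u t).2))
    (hδ : 0 < δ) (hδ1 : δ ≤ 1) :
    ∀ᶠ ε in nhdsWithin 0 (Set.Ioi 0), ∃ p : ℝ → ℝ × ℝ,
      IsPeriodicSol (hesterField γ α μ κ ε) p ∧
      Set.range p ⊆ Metric.closedBall (0 : ℝ × ℝ) r ∧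
      (∀ q : ℝ → ℝ × ℝ, IsPeriodicSol (hesterField γ α μ κ ε) q →
        Set.range q ⊆ Metric.closedBall (0 : ℝ × ℝ) r → Set.range q = Set.range p) ∧
      Metric.hausdorffDist (Set.range p) ((u '' Set.Icc 0 τ) ∪
        (Set.Icc D (μ * expDiff α κ (foldPoint α κ)) ×ˢ ({0} : Set ℝ))) ≤ δ := by
  obtain ⟨heX, S, L, m, hprof⟩ := eventually_isProfile hγ hα hμ hκ hκα hr
  have hball : ∀ p : ℝ × ℝ, p ∈ Metric.closedBall (0 : ℝ × ℝ) r ↔ |p.1| ≤ r ∧ |p.2| ≤ r := by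
    intro p
    rw [mem_closedBall_zero_iff, Prod.norm_def, max_le_iff, Real.norm_eq_abs, Real.norm_eq_abs]
  filter_upwards [hprof, eventually_unique_cycle (μ := μ) r (foldPoint α κ) (zeroPoint α κ) S L m A
    hγ heX hX hδ] with ε hG H
  obtain ⟨G, K, hK, P, hGc, hGl, hGF⟩ := hG
  obtain ⟨x, y, T, h, hper, htr, huniq⟩ := H G K hK P hGc hGl
  have hp : Function.Periodic (fun t => (x t, y t)) T := fun t => Prod.ext (hper t).1 (hper t).2
  have hb : ∀ t, |x t| ≤ r ∧ |y t| ≤ r := by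
    intro t
    obtain ⟨s, hs, hst⟩ := hp.exists_mem_Ico₀ htr.pos t
    simp only [Prod.mk.injEq] at hst
    have := (htr.near s ⟨hs.1, hs.2.le⟩).abs_le_add A hX
    rw [hst.1, hst.2]
    constructor <;> linarith
  refine ⟨fun t => (x t, y t), ⟨fun t => ?_, ⟨T, htr.pos, hp⟩, ?_⟩, ?_, ?_,
    htr.hausdorffDist_le hδ.le hper⟩
  · exact h.hasDerivAt_hesterField (hGF _ (abs_le.1 (hb t).2).2)
  · obtain ⟨t, ht⟩ := htr.ne
    exact ⟨t, 0, fun hne => ht (congrArg Prod.fst hne)⟩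
  · rintro _ ⟨t, rfl⟩
    exact (hball _).2 (hb t)
  · rintro q ⟨hq, ⟨T', hT', hq_per⟩, t₁, t₂, hne⟩ hq_ball
    have hqb : ∀ t, |(q t).1| ≤ r ∧ |(q t).2| ≤ r := fun t => (hball _).1 (hq_ball ⟨t, rfl⟩)
    have hqG := isTraj_of_hesterField hq fun t => hGF _ (abs_le.1 (hqb t).2).2
    obtain ⟨c, hc⟩ := huniq _ _ T' hqG hT' (fun t => by simp [hq_per]) ⟨t₁, t₂, hne⟩
      (fun t => (abs_le.1 (hqb t).1).1)
    refine Set.Subset.antisymm ?_ ?_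
    · rintro _ ⟨t, rfl⟩
      refine ⟨t - c, ?_⟩
      have := hc (t - c)
      rw [sub_add_cancel] at this
      exact Prod.ext this.1.symm this.2.symm
    · rintro _ ⟨t, rfl⟩
      exact ⟨t + c, Prod.ext (hc t).1 (hc t).2⟩

/-- The limit cycles `Γ_ε` of the Hester system converge in Hausdorff distance, as
`ε → 0⁺`, to the singular cycle `Γ₀ = Γ¹ ∪ Γ²`. -/
theorem hester_cycle_convergence (γ α μ κ : ℝ) (hγ : γ ∈ Set.Ioo (0 : ℝ) 1) (hα : 0 < α)
    (hμ : 0 < μ) (hκ : 0 < κ) (hκα : κ * (1 + α) ∈ Set.Ioo (0 : ℝ) 1)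
    (x_j ω x_d : ℝ)
    (hxj : x_j = μ * α / ((1 + α) ^ ((1 + α) / α) * κ ^ (1 / α)))
    (hω : ω = Real.sqrt (1 - γ ^ 2))
    (hxd : x_d = -x_j * Real.exp (-γ * Real.pi / ω))
    (u : ℝ → ℝ × ℝ)
    (hu : ∀ t : ℝ, HasDerivAt u ((u t).2, -(u t).1 - 2 * γ * (u t).2) t)
    (hu0 : u 0 = (x_j, 0)) :
    ∃ R > (0 : ℝ), ∀ r : ℝ, R ≤ r → ∃ ε₀ > (0 : ℝ),
      (∀ ε ∈ Set.Ioo (0 : ℝ) ε₀, ∃ p : ℝ → ℝ × ℝ,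
        IsPeriodicSol (hesterField γ α μ κ ε) p ∧
        Set.range p ⊆ Metric.closedBall (0 : ℝ × ℝ) r ∧
        (∀ q : ℝ → ℝ × ℝ, IsPeriodicSol (hesterField γ α μ κ ε) q →
          Set.range q ⊆ Metric.closedBall (0 : ℝ × ℝ) r → Set.range q = Set.range p)) ∧
      (∀ Γ : ℝ → Set (ℝ × ℝ),
        (∀ ε ∈ Set.Ioo (0 : ℝ) ε₀, ∃ p : ℝ → ℝ × ℝ,
          IsPeriodicSol (hesterField γ α μ κ ε) p ∧
          Set.range p ⊆ Metric.closedBall (0 : ℝ × ℝ) r ∧ Γ ε = Set.range p) →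
        Filter.Tendsto
          (fun ε => Metric.hausdorffDist (Γ ε)
            ((u '' Set.Icc 0 (Real.pi / ω)) ∪ (Set.Icc x_d x_j ×ˢ ({0} : Set ℝ))))
          (nhdsWithin 0 (Set.Ioi (0 : ℝ))) (nhds 0)) := by
  have hX : 0 < x_j := by
    have := hγ.1
    rw [hxj]
    have h1 : 0 < (1 + α) ^ ((1 + α) / α) := Real.rpow_pos_of_pos (by linarith) _
    have h2 : 0 < κ ^ (1 / α) := Real.rpow_pos_of_pos hκ _
    positivity
  have A := isLinArc_of_flow hγ hX hω hxd hu hu0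
  obtain rfl : x_j = μ * expDiff α κ (foldPoint α κ) := hxj.trans (fold_value_eq hα hκ μ)
  refine ⟨μ * expDiff α κ (foldPoint α κ) + 1, by linarith, fun r hr => ?_⟩
  have key := fun (δ : ℝ) (hδ : 0 < δ) (hδ1 : δ ≤ 1) =>
    eventually_hester_cycle hγ.1 hα hμ hκ hκα.2 hX hr A hδ hδ1
  obtain ⟨ε₀, hε₀, hsub⟩ := mem_nhdsGT_iff_exists_Ioo_subset.1 (key 1 one_pos le_rfl)
  refine ⟨ε₀, hε₀, fun ε hε => ?_, fun Γ hΓ => ?_⟩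
  · obtain ⟨p, h1, h2, h3, -⟩ := hsub hε
    exact ⟨p, h1, h2, h3⟩
  · rw [Metric.tendsto_nhds]
    intro δ hδ
    have hδ' : 0 < min (δ / 2) 1 := lt_min (by linarith) one_pos
    filter_upwards [key _ hδ' (min_le_right _ _), Ioo_mem_nhdsGT hε₀] with ε hp hε
    obtain ⟨p, -, -, h3, h4⟩ := hp
    obtain ⟨q, hq, hqb, hΓq⟩ := hΓ ε hε
    rw [Real.dist_eq, sub_zero, abs_of_nonneg Metric.hausdorffDist_nonneg, hΓq, h3 q hq hqb]
    have := min_le_left (δ / 2) 1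
    linarith
end

section
/- Fix real parameters γ ∈ (0,1), α > 0, μ > 0, κ > 0 with κ(1+α) > 1. Then for every r > 0 there exists ε₀ > 0 such that for every ε ∈ (0, ε₀) the Hester system with parameters γ, α, μ, κ, ε has no nonconstant periodic solution whose image is contained in the closed ball of radius r centered at the origin. -/
/-- A monotone periodic function on the line is constant. -/
theorem Function.Periodic.eq_of_monotone {f : ℝ → ℝ} {T : ℝ} (hf : Function.Periodic f T)
    (hT : 0 < T) (hmono : Monotone f) (a b : ℝ) : f a = f b := by
  have key : ∀ a b : ℝ, f b ≤ f a := by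
    intro a b
    obtain ⟨n, hn⟩ := Archimedean.arch (b - a) hT
    rw [← hf.nsmul n a]
    exact hmono (by linarith)
  exact le_antisymm (key b a) (key a b)

/-- A continuous periodic function on the line attains its minimum. -/
theorem Function.Periodic.exists_forall_ge {f : ℝ → ℝ} {T : ℝ} (hf : Function.Periodic f T)
    (hT : 0 < T) (hc : Continuous f) : ∃ a, ∀ t, f a ≤ f t := by
  obtain ⟨_, ⟨a, rfl⟩, ha⟩ :=
    (hf.compact_of_continuous hT.ne' hc).exists_isLeast (Set.range_nonempty f)
  exact ⟨a, fun t => ha ⟨t, rfl⟩⟩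

theorem exp_sub_mul_exp_le {α κ s : ℝ} (hα : 0 < α) (hκ : 0 < κ) (hκα : 1 < κ * (1 + α))
    (hs : 0 ≤ s) :
    Real.exp s - κ * Real.exp ((1 + α) * s) ≤ 1 - κ - (κ * (1 + α) - 1) * s := by
  have h1 : s + 1 ≤ Real.exp s := Real.add_one_le_exp s
  have h2 : 1 + (1 + α) * (Real.exp s - 1) ≤ Real.exp ((1 + α) * s) := by
    have := one_add_mul_self_le_rpow_one_add (s := Real.exp s - 1) (by linarith)
      (p := 1 + α) (by linarith)
    rwa [add_sub_cancel, ← Real.exp_mul, mul_comm s] at this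
  nlinarith [mul_le_mul_of_nonneg_left h2 hκ.le,
    mul_nonneg (sub_nonneg.2 hκα.le) (sub_nonneg.2 h1)]

/-- For `ε` small the equilibrium `(μ(1-κ), 0)` is overdamped on the side `y ≥ 0`. -/
theorem hesterField_snd_le {γ α μ κ ε : ℝ} (hα : 0 < α) (hμ : 0 < μ) (hκ : 0 < κ)
    (hκα : 1 < κ * (1 + α)) (hε : 0 < ε) (hε' : ε < μ * (κ * (1 + α) - 1) / 2) {q : ℝ × ℝ}
    (hq : 0 ≤ q.2) :
    (hesterField γ α μ κ ε q).2 ≤ μ * (1 - κ) - q.1 - 2 * (1 + γ) * q.2 := by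
  have h := mul_le_mul_of_nonneg_left
    (exp_sub_mul_exp_le hα hκ hκα (div_nonneg hq hε.le)) hμ.le
  have h2 : 2 * q.2 ≤ μ * (κ * (1 + α) - 1) * (q.2 / ε) := by
    calc 2 * q.2 = 2 * ε * (q.2 / ε) := by field_simp
      _ ≤ _ := mul_le_mul_of_nonneg_right (by linarith) (div_nonneg hq hε.le)
  simp only [hesterField, mul_div_assoc]
  linarith

/-- If a solution of `x' = y` starts on `y = 0` with `x < c`, where `y' = c - x` whenever `y = 0`
and `y' ≤ c - x - 2 * y` whenever `y ≥ 0`, then `y` stays nonnegative. -/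
theorem nonneg_of_overdamped {x y y' : ℝ → ℝ} {c a : ℝ} (hx : ∀ t, HasDerivAt x (y t) t)
    (hy : ∀ t, HasDerivAt y (y' t) t) (hzero : ∀ t, y t = 0 → y' t = c - x t)
    (hle : ∀ t, 0 ≤ y t → y' t ≤ c - x t - 2 * y t) (hya : y a = 0) (hxa : x a < c)
    {t : ℝ} (hat : a ≤ t) : 0 ≤ y t := by
  have hxc : Continuous x := continuous_iff_continuousAt.2 fun t => (hx t).continuousAt
  have hyc : Continuous y := continuous_iff_continuousAt.2 fun t => (hy t).continuousAt
  let W : ℝ → ℝ := fun t => Real.exp t * (y t + x t - c)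
  have hW : ∀ t, HasDerivAt W
      (Real.exp t * (y t + x t - c) + Real.exp t * (y' t + y t)) t := fun t =>
    (Real.hasDerivAt_exp t).mul (((hy t).add (hx t)).sub_const c)
  have hWc : Continuous W := continuous_iff_continuousAt.2 fun t => (hW t).continuousAt
  have hWa : W a < 0 := mul_neg_of_pos_of_neg (Real.exp_pos a) (by linarith)
  have key : Set.Icc a t ⊆ {u | 0 ≤ y u ∧ W u ≤ W a} := by
    refine IsClosed.Icc_subset_of_forall_exists_gt ?_ ⟨hya.ge, le_rfl⟩ ?_
    · exact ((isClosed_le continuous_const hyc).inter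
        (isClosed_le hWc continuous_const)).inter isClosed_Icc
    · rintro u ⟨⟨hyu, hWu⟩, -⟩ v (huv : u < v)
      have hev : ∀ᶠ s in nhdsWithin u (Set.Ioi u), 0 ≤ y s := by
        rcases hyu.eq_or_lt with h0 | hpos
        · have hneg : y u + x u - c < 0 := by
            by_contra! h
            exact absurd (mul_nonneg (Real.exp_pos u).le h) (not_le.2 (hWu.trans_lt hWa))
          have hpos : 0 < y' u := by rw [hzero u h0.symm]; linarith
          have hs := (hasDerivAt_iff_tendsto_slope.1 (hy u)).eventually (lt_mem_nhds hpos)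
          have hs' := hs.filter_mono (nhdsWithin_mono u fun s (hs : u < s) => hs.ne')
          filter_upwards [hs', self_mem_nhdsWithin] with s hs (hus : u < s)
          rw [slope_def_field, ← h0, sub_zero] at hs
          exact ((div_pos_iff_of_pos_right (sub_pos.2 hus)).1 hs).le
        · exact ((hyc.continuousAt.eventually (lt_mem_nhds hpos)).filter_mono
            nhdsWithin_le_nhds).mono fun s hs => hs.le
      obtain ⟨d, (hud : u < d), hd⟩ := (mem_nhdsGT_iff_exists_Ioc_subset).1 hev
      have hyn : ∀ s ∈ Set.Icc u d, 0 ≤ y s := fun s hs => by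
        rcases hs.1.eq_or_lt with rfl | h
        · exact hyu
        · exact hd ⟨h, hs.2⟩
      have hanti : AntitoneOn W (Set.Icc u d) := by
        refine antitoneOn_of_deriv_nonpos (convex_Icc u d) hWc.continuousOn
          (fun s _ => (hW s).differentiableAt.differentiableWithinAt) fun s hs => ?_
        have := hle s (hyn s (interior_subset hs))
        rw [(hW s).deriv, ← mul_add]
        exact mul_nonpos_of_nonneg_of_nonpos (Real.exp_pos s).le (by linarith)
      refine ⟨min d v, ⟨hyn _ ⟨(lt_min hud huv).le, min_le_left _ _⟩, ?_⟩,
        lt_min hud huv, min_le_right _ _⟩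
      exact (hanti ⟨le_rfl, hud.le⟩ ⟨(lt_min hud huv).le, min_le_left _ _⟩
        (lt_min hud huv).le).trans hWu
  exact (key ⟨hat, le_rfl⟩).1

/-- If `κ(1+α) > 1`, the Hester system has no limit cycles in any fixed ball for
sufficiently small `ε > 0`. -/
theorem hester_no_cycles (γ α μ κ : ℝ) (hγ : γ ∈ Set.Ioo (0 : ℝ) 1) (hα : 0 < α)
    (hμ : 0 < μ) (hκ : 0 < κ) (hκα : 1 < κ * (1 + α)) :
    ∀ r > (0 : ℝ), ∃ ε₀ > (0 : ℝ), ∀ ε ∈ Set.Ioo (0 : ℝ) ε₀,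
      ¬ ∃ p : ℝ → ℝ × ℝ, IsPeriodicSol (hesterField γ α μ κ ε) p ∧
        Set.range p ⊆ Metric.closedBall (0 : ℝ × ℝ) r := by
  obtain ⟨hγ, -⟩ := hγ
  intro r _
  refine ⟨μ * (κ * (1 + α) - 1) / 2, half_pos (mul_pos hμ (by linarith)), ?_⟩
  rintro ε ⟨hε, hε'⟩ ⟨p, ⟨hp, ⟨T, hT, hper⟩, t₁, t₂, hne⟩, -⟩
  have hx : ∀ t, HasDerivAt (fun t => (p t).1) (p t).2 t := fun t => (hp t).fst
  have hy : ∀ t, HasDerivAt (fun t => (p t).2) (hesterField γ α μ κ ε (p t)).2 t :=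
    fun t => (hp t).snd
  have hxper : Function.Periodic (fun t => (p t).1) T := fun t => by simp only [hper]
  have hyper : Function.Periodic (fun t => (p t).2) T := fun t => by simp only [hper]
  have hxc : Continuous fun t => (p t).1 :=
    continuous_iff_continuousAt.2 fun t => (hx t).continuousAt
  have hyc : Continuous fun t => (p t).2 :=
    continuous_iff_continuousAt.2 fun t => (hy t).continuousAt
  have hle : ∀ t, 0 ≤ (p t).2 → (hesterField γ α μ κ ε (p t)).2 ≤
      μ * (1 - κ) - (p t).1 - 2 * (1 + γ) * (p t).2 := fun t ht =>
    hesterField_snd_le hα hμ hκ hκα hε hε' ht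
  have hconst : ¬ ∀ a b, (p a).1 = (p b).1 := by
    intro h
    have hy0 : ∀ t, (p t).2 = 0 := fun t =>
      (hx t).unique ((hasDerivAt_const t (p t₁).1).congr_of_eventuallyEq
        (Filter.Eventually.of_forall fun s => h s t₁))
    exact hne (Prod.ext (h t₁ t₂) ((hy0 t₁).trans (hy0 t₂).symm))
  obtain ⟨a, ha⟩ := hxper.exists_forall_ge hT hxc
  have hya : (p a).2 = 0 :=
    IsLocalMin.hasDerivAt_eq_zero (Filter.Eventually.of_forall ha) (hx a)
  rcases lt_or_ge (p a).1 (μ * (1 - κ)) with hlt | hge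
  · have hnn : ∀ t, a ≤ t → 0 ≤ (p t).2 := fun t hat => by
      refine nonneg_of_overdamped hx hy (c := μ * (1 - κ)) (fun t ht => ?_) (fun t ht => ?_)
        hya hlt hat
      · simp only [hesterField, ht, mul_zero, zero_div, Real.exp_zero]
        ring
      · linarith [hle t ht, mul_nonneg hγ.le ht]
    refine hconst (hxper.eq_of_monotone hT (monotone_of_deriv_nonneg
      (fun t => (hx t).differentiableAt) fun t => ?_))
    rw [(hx t).deriv]
    obtain ⟨n, hn⟩ := Archimedean.arch (a - t) hT
    have := hnn (t + n • T) (by linarith)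
    exact this.trans_eq (hyper.nsmul n t)
  · have hynper : Function.Periodic (fun t => -(p t).2) T := fun t => by simp only [hper]
    obtain ⟨b, hb⟩ := hynper.exists_forall_ge hT hyc.neg
    have hb0 : (p b).2 ≤ 0 := by
      by_contra! hpos
      have h0 : (hesterField γ α μ κ ε (p b)).2 = 0 :=
        IsLocalMax.hasDerivAt_eq_zero
          (Filter.Eventually.of_forall fun t => neg_le_neg_iff.1 (hb t)) (hy b)
      have := hle b hpos.le
      have := ha b
      have := mul_pos hγ hpos
      linarith
    have hxnper : Function.Periodic (fun t => -(p t).1) T := fun t => by simp only [hper]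
    refine hconst fun u v => neg_injective (hxnper.eq_of_monotone hT (monotone_of_deriv_nonneg
      (fun t => (hx t).neg.differentiableAt) fun t => ?_) u v)
    have hd : deriv (fun t => -(p t).1) t = -(p t).2 := (hx t).neg.deriv
    rw [hd]
    exact le_trans (by linarith) (hb t)
end
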